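/- arXiv:1407.4525 — 3 statements merged into one kernel-verified Lean document; each statement's English description precedes it below -/
import Mathlib

section
/- Strict negativity of the second expansion coefficient of the ground state: let d ≥ 11 and p > p_JL. In the asymptotic expansion ∂_y^k Q(y) = ∂_y^k[c_∞ y^{−2/(p−1)} + a₁ y^{−γ}] + O(y^{−γ−g−k}) (valid as y → ∞ for every integer k ≥ 0 and every 0 < g < min(α, α₂−α)), the coefficient a₁ is strictly negative: a₁ < 0. -/
noncomputable section

open Real MeasureTheory Filter Asymptotics Set Topology ENNReal

namespace WaveBlowup

/-- The Joseph–Lundgren exponent `p_JL = 1 + 4/(d-4-2√(d-1))`. -/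
def pJL (d : ℕ) : ℝ := 1 + 4 / ((d : ℝ) - 4 - 2 * Real.sqrt ((d : ℝ) - 1))

/-- The critical Sobolev exponent `s_c = d/2 - 2/(p-1)`. -/
def sCrit (d : ℕ) (p : ℝ) : ℝ := (d : ℝ) / 2 - 2 / (p - 1)

/-- `c_∞ = [(2/(p-1))(d-2-2/(p-1))]^{1/(p-1)}`. -/
def cInfty (d : ℕ) (p : ℝ) : ℝ :=
  ((2 / (p - 1)) * ((d : ℝ) - 2 - 2 / (p - 1))) ^ ((1 : ℝ) / (p - 1))

/-- `△ = (d-2)² - 4 p c_∞^{p-1}`. -/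
def discr (d : ℕ) (p : ℝ) : ℝ := ((d : ℝ) - 2) ^ 2 - 4 * p * cInfty d p ^ (p - 1)

/-- `γ = (d-2-√△)/2`. -/
def gam (d : ℕ) (p : ℝ) : ℝ := (((d : ℝ) - 2) - Real.sqrt (discr d p)) / 2

/-- `α = γ - 2/(p-1)`, the smaller root of `X² - (d-2-4/(p-1))X + 2(d-2-2/(p-1))`. -/
def alph (d : ℕ) (p : ℝ) : ℝ := gam d p - 2 / (p - 1)

/-- `α₂`, the other root of the same quadratic (the sum of the roots is `d-2-4/(p-1)`). -/
def alph₂ (d : ℕ) (p : ℝ) : ℝ := ((d : ℝ) - 2 - 4 / (p - 1)) - alph d p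

/-- `k₀ = ⌊d/2 - γ⌋`. -/
def kzero (d : ℕ) (p : ℝ) : ℕ := ⌊(d : ℝ) / 2 - gam d p⌋₊

/-- `δ₀ = d/2 - γ - k₀ ∈ (0,1)`. -/
def deltazero (d : ℕ) (p : ℝ) : ℝ := (d : ℝ) / 2 - gam d p - (kzero d p : ℝ)

/-- `g = min(α, α₂ - α) - ε`. -/
def gconst (d : ℕ) (p ε : ℝ) : ℝ := min (alph d p) (alph₂ d p - alph d p) - ε

/-- `g' = min(g, 2, 1 + δ₀ - ε)`. -/
def gpconst (d : ℕ) (p ε : ℝ) : ℝ := min (gconst d p ε) (min 2 (1 + deltazero d p - ε))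

/-- The ground state `Q` in radial representation: the unique smooth positive radially
symmetric solution of `ΔQ + Q^p = 0` on `ℝ^d` with `Q(0) = 1`. -/
structure IsGroundState (d : ℕ) (p : ℝ) (Q : ℝ → ℝ) : Prop where
  smooth : ContDiff ℝ (⊤ : ℕ∞) Q
  pos : ∀ y : ℝ, 0 ≤ y → 0 < Q y
  ode : ∀ y : ℝ, 0 < y →
    deriv (deriv Q) y + ((d : ℝ) - 1) / y * deriv Q y + Q y ^ p = 0
  at0 : Q 0 = 1
  deriv0 : deriv Q 0 = 0

/-- `Λ⁽¹⁾Q = (2/(p-1) + y ∂_y) Q`. -/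
def Lam1 (p : ℝ) (Q : ℝ → ℝ) : ℝ → ℝ := fun y => 2 / (p - 1) * Q y + y * deriv Q y

/-- The potential `W = ∂_y (log Λ⁽¹⁾Q)`. -/
def Wpot (p : ℝ) (Q : ℝ → ℝ) : ℝ → ℝ := fun y => deriv (fun z => Real.log (Lam1 p Q z)) y

/-- `A u = -∂_y u + W u`. -/
def Aop (p : ℝ) (Q : ℝ → ℝ) (u : ℝ → ℝ) : ℝ → ℝ :=
  fun y => -deriv u y + Wpot p Q y * u y

/-- `A* u = y^{1-d} ∂_y (y^{d-1} u) + W u`. -/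
def Astar (d : ℕ) (p : ℝ) (Q : ℝ → ℝ) (u : ℝ → ℝ) : ℝ → ℝ :=
  fun y => deriv (fun z => z ^ (d - 1) * u z) y / y ^ (d - 1) + Wpot p Q y * u y

/-- The linearized operator `L = -Δ - pQ^{p-1}` on radial functions. -/
def Lop (d : ℕ) (p : ℝ) (Q : ℝ → ℝ) (u : ℝ → ℝ) : ℝ → ℝ :=
  fun y => -(deriv (deriv u) y + ((d : ℝ) - 1) / y * deriv u y) - p * Q y ^ (p - 1) * u y

/-- Adapted derivatives: `u_0 = u`, `u_{k+1} = A u_k` for `k` even, `u_{k+1} = A* u_k`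
for `k` odd. -/
def adap (d : ℕ) (p : ℝ) (Q : ℝ → ℝ) : ℕ → (ℝ → ℝ) → (ℝ → ℝ)
  | 0, u => u
  | (k+1), u => if k % 2 = 0 then Aop p Q (adap d p Q k u) else Astar d p Q (adap d p Q k u)


lemma params (d : ℕ) (hd : 11 ≤ d) (p : ℝ) (hp1 : 1 < p) (hp : pJL d < p) :
    0 < cInfty d p ∧ cInfty d p ^ (p - 1) = 2 / (p - 1) * ((d : ℝ) - 2 - 2 / (p - 1)) ∧
    0 < alph d p ∧ 0 < alph₂ d p - alph d p ∧
    gam d p * (d - 2 - gam d p) = p * cInfty d p ^ (p - 1) := by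
  have hd' : (11 : ℝ) ≤ d := by exact_mod_cast hd
  set q := Real.sqrt ((d : ℝ) - 1) with hq
  have hq2 : q ^ 2 = d - 1 := Real.sq_sqrt (by linarith)
  have hq0 : 0 ≤ q := Real.sqrt_nonneg _
  have hD : 0 < (d : ℝ) - 4 - 2 * q := by nlinarith
  have hp' : 4 / ((d : ℝ) - 4 - 2 * q) < p - 1 := by
    have := hp
    unfold pJL at this
    rw [← hq] at this
    linarith
  have hp0 : 0 < p - 1 := by linarith
  obtain ⟨m, hm⟩ : ∃ m, m = 2 / (p - 1) := ⟨_, rfl⟩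
  have hm0 : 0 < m := by rw [hm]; positivity
  have hmp : m * (p - 1) = 2 := by rw [hm]; field_simp
  have hmD : 2 * m < (d : ℝ) - 4 - 2 * q := by
    rw [div_lt_iff₀ hD] at hp'
    by_contra h
    push Not at h
    nlinarith
  have hbase : 0 < m * ((d : ℝ) - 2 - m) := mul_pos hm0 (by linarith)
  have hc : 0 < cInfty d p := by
    unfold cInfty; rw [← hm]; positivity
  have hcp : cInfty d p ^ (p - 1) = m * ((d : ℝ) - 2 - m) := by
    unfold cInfty; rw [← hm, ← Real.rpow_mul hbase.le, one_div, inv_mul_cancel₀ hp0.ne', Real.rpow_one]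
  have hdisc : discr d p = ((d : ℝ) - 2 - 2 * m - 2) ^ 2 - 4 * (d - 1) := by
    unfold discr; rw [hcp]; linear_combination (-4 * ((d : ℝ) - 2 - m)) * hmp
  have hdp : 0 < discr d p := by rw [hdisc]; nlinarith
  set r := Real.sqrt (discr d p) with hr
  have hr0 : 0 < r := Real.sqrt_pos.2 hdp
  have hr2 : r ^ 2 = discr d p := Real.sq_sqrt hdp.le
  have hrl : r < (d : ℝ) - 2 - 2 * m := by
    apply lt_of_pow_lt_pow_left₀ 2 (by linarith)
    rw [hr2, hdisc]; nlinarith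
  have hg : gam d p = ((d : ℝ) - 2 - r) / 2 := rfl
  have h4 : 4 / (p - 1) = 2 * m := by rw [hm]; ring
  refine ⟨hc, by rw [hcp, hm], ?_, ?_, ?_⟩
  · unfold alph; rw [← hm, hg]; linarith
  · unfold alph₂ alph; rw [h4, ← hm, hg]; linarith
  · have h1 : discr d p = ((d : ℝ) - 2) ^ 2 - 4 * p * cInfty d p ^ (p - 1) := rfl
    rw [h1] at hr2
    rw [hg]; linear_combination (-1 / 4) * hr2

lemma tangent (p c v : ℝ) (hp : 1 < p) (hc : 0 < c) (hv : 0 < v) :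
    p * c ^ (p - 1) * v - (p - 1) * c ^ (p - 1) * c ≤ v ^ p := by
  have h := one_add_mul_self_le_rpow_one_add (s := v / c - 1) (by have := div_pos hv hc; linarith) hp.le
  have e : (1 + (v / c - 1)) ^ p = v ^ p / c ^ p := by
    rw [← Real.div_rpow hv.le hc.le]; congr 1; ring
  rw [e, le_div_iff₀ (by positivity)] at h
  have e2 : c ^ p = c ^ (p - 1) * c := by
    rw [← Real.rpow_add_one hc.ne']; congr 1; ring
  rw [e2] at h
  refine le_trans (le_of_eq ?_) h
  field_simp
  ring

lemma core (n p m c al be ga a g : ℝ) (Q : ℝ → ℝ) (hs : ContDiff ℝ (⊤ : ℕ∞) Q)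
    (hpos : ∀ y : ℝ, 0 ≤ y → 0 < Q y)
    (hode : ∀ y : ℝ, 0 < y → deriv (deriv Q) y + (n - 1) / y * deriv Q y + Q y ^ p = 0)
    (hp : 1 < p) (hm : 0 < m) (hmp : m * (p - 1) = 2) (hc : 0 < c)
    (hal : 0 < al) (hbe : 0 < be - al) (hga : ga = al + m) (hab : al + be = n - 2 - 2 * m)
    (hgg : (m + be) * ga = p * c ^ (p - 1)) (hprod : al * be = (p - 1) * c ^ (p - 1))
    (hg : 0 < g)
    (h0 : (fun y : ℝ => Q y - (c * y ^ (-m) + a * y ^ (-ga))) =O[atTop] fun y : ℝ => y ^ (-ga - g))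
    (h1 : (fun y : ℝ => deriv Q y - (c * (-m * y ^ (-m - 1)) + a * (-ga * y ^ (-ga - 1))))
      =O[atTop] fun y : ℝ => y ^ (-ga - g - 1)) : a < 0 := by
  have hQ1 : ∀ y, HasDerivAt Q (deriv Q y) y := fun y =>
    ((hs.differentiable (by simp)) y).hasDerivAt
  have hs2 : ContDiff ℝ 1 (deriv Q) := by
    have : ContDiff ℝ (1 + 1) Q := hs.of_le (by norm_cast)
    exact (contDiff_succ_iff_deriv.1 this).2.2
  have hQ2 : ∀ y, HasDerivAt (deriv Q) (deriv (deriv Q) y) y := fun y =>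
    ((hs2.differentiable (by simp)) y).hasDerivAt
  set F : ℝ → ℝ := fun y => y ^ (ga + 1) * deriv Q y + (m + be) * (y ^ ga * Q y)
    - be * c * y ^ al with hF
  -- derivative
  have hFd : ∀ y, 0 < y → ∃ F', HasDerivAt F F' y ∧ F' ≤ 0 := by
    intro y hy
    have d1 := (Real.hasDerivAt_rpow_const (x := y) (p := ga + 1) (Or.inl hy.ne')).mul (hQ2 y)
    have d2 := ((Real.hasDerivAt_rpow_const (x := y) (p := ga) (Or.inl hy.ne')).mul (hQ1 y)).const_mul (m + be)
    have d3 := (Real.hasDerivAt_rpow_const (x := y) (p := al) (Or.inl hy.ne')).const_mul (be * c)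
    refine ⟨_, (d1.add d2).sub d3, ?_⟩
    have ht := tangent p c (y ^ m * Q y) hp hc (mul_pos (by positivity) (hpos y hy.le))
    rw [Real.mul_rpow (by positivity) (hpos y hy.le).le, ← Real.rpow_mul hy.le] at ht
    have hmp2 : m * p = m + 1 + 1 := by linarith
    rw [hmp2, Real.rpow_add_one hy.ne', Real.rpow_add_one hy.ne'] at ht
    have e0 : y ^ al = y ^ (al - 1) * y := by
      rw [← Real.rpow_add_one hy.ne']; congr 1; ring
    have e1 : y ^ ga = y ^ (al - 1) * y ^ m * y := by
      rw [hga, Real.rpow_add hy, e0]; ring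
    have e2 : y ^ (ga + 1) = y ^ (al - 1) * y ^ m * y * y := by
      rw [Real.rpow_add_one hy.ne', e1]
    have e3 : y ^ (ga - 1) = y ^ (al - 1) * y ^ m := by
      rw [← Real.rpow_add hy]; congr 1; linarith
    have e4 : y ^ (ga + 1 - 1) = y ^ (al - 1) * y ^ m * y := by
      rw [← e1]; congr 1; ring
    rw [e4, e3, e2, e1]
    have ho := hode y hy
    have ho2 : y * deriv (deriv Q) y + (n - 1) * deriv Q y + y * Q y ^ p = 0 := by
      have : y * (deriv (deriv Q) y + (n - 1) / y * deriv Q y + Q y ^ p) = 0 := by rw [ho]; ring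
      rw [← this]; field_simp
    have hA : 0 < y ^ (al - 1) := by positivity
    have := mul_le_mul_of_nonneg_left ht hA.le
    set A := y ^ (al - 1)
    set M := y ^ m
    set K := c ^ (p - 1)
    have hn : n = ga + 2 + m + be := by linarith
    subst hn
    refine le_trans (le_of_eq ?_) (sub_nonpos.2 this)
    linear_combination A * M * y * ho2 + A * M * Q y * hgg - c * A * hprod
  have hanti : AntitoneOn F (Ioi 0) := by
    apply antitoneOn_of_deriv_nonpos (convex_Ioi 0)
    · intro y hy
      obtain ⟨F', h, _⟩ := hFd y hy
      exact h.continuousAt.continuousWithinAt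
    · intro y hy
      rw [interior_Ioi] at hy
      obtain ⟨F', h, _⟩ := hFd y hy
      exact h.differentiableAt.differentiableWithinAt
    · intro y hy
      rw [interior_Ioi] at hy
      obtain ⟨F', h, h'⟩ := hFd y hy
      rwa [h.deriv]
  -- negativity near zero
  obtain ⟨y0, hy0, hFy0⟩ : ∃ y0, 0 < y0 ∧ F y0 < 0 := by
    have hcont : Continuous fun y : ℝ => y ^ (m + 1) * deriv Q y + (m + be) * (y ^ m * Q y) - be * c := by
      have c1 : Continuous fun y : ℝ => y ^ (m + 1) := Real.continuous_rpow_const (by linarith)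
      have c2 : Continuous fun y : ℝ => y ^ m := Real.continuous_rpow_const hm.le
      have c3 := hs.continuous
      have c4 := hs2.continuous
      fun_prop
    have hev := (hcont.tendsto 0).eventually_lt_const (u := 0) (by
      rw [Real.zero_rpow (by linarith), Real.zero_rpow hm.ne']
      have : 0 < be * c := mul_pos (by linarith) hc
      linarith)
    have hev2 : ∀ᶠ y in 𝓝[>] (0 : ℝ), y ^ (m + 1) * deriv Q y + (m + be) * (y ^ m * Q y) - be * c < 0 :=
      hev.filter_mono nhdsWithin_le_nhds
    obtain ⟨y, hy, hy'⟩ := (hev2.and self_mem_nhdsWithin).exists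
    have hy' : 0 < y := hy'
    refine ⟨y, hy', ?_⟩
    have : F y = y ^ al * (y ^ (m + 1) * deriv Q y + (m + be) * (y ^ m * Q y) - be * c) := by
      simp only [hF]
      rw [hga, show al + m + 1 = al + (m + 1) by ring, Real.rpow_add hy', Real.rpow_add hy' al m]; ring
    rw [this]
    exact mul_neg_of_pos_of_neg (by positivity) hy
  -- limit at infinity
  have hlim : Tendsto F atTop (𝓝 (a * (be - al))) := by
    have hz : Tendsto (fun y : ℝ => y ^ (-g)) atTop (𝓝 0) := tendsto_rpow_neg_atTop hg
    have l1 : Tendsto (fun y : ℝ => y ^ (ga + 1) * (deriv Q y - (c * (-m * y ^ (-m - 1)) + a * (-ga * y ^ (-ga - 1))))) atTop (𝓝 0) := by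
      refine (((isBigO_refl (fun y : ℝ => y ^ (ga + 1)) atTop).mul h1).congr' EventuallyEq.rfl ?_).trans_tendsto hz
      filter_upwards [eventually_gt_atTop 0] with y hy
      rw [← Real.rpow_add hy]; congr 1; ring
    have l0 : Tendsto (fun y : ℝ => y ^ ga * (Q y - (c * y ^ (-m) + a * y ^ (-ga)))) atTop (𝓝 0) := by
      refine (((isBigO_refl (fun y : ℝ => y ^ ga) atTop).mul h0).congr' EventuallyEq.rfl ?_).trans_tendsto hz
      filter_upwards [eventually_gt_atTop 0] with y hy
      rw [← Real.rpow_add hy]; congr 1; ring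
    have l2 := (l1.add (l0.const_mul (m + be))).add_const (a * (be - al))
    rw [mul_zero, add_zero, zero_add] at l2
    refine l2.congr' ?_
    filter_upwards [eventually_gt_atTop 0] with y hy
    have f1 : y ^ (ga + 1) * y ^ (-m - 1) = y ^ al := by
      rw [← Real.rpow_add hy]; congr 1; linarith
    have f2 : y ^ (ga + 1) * y ^ (-ga - 1) = 1 := by
      rw [← Real.rpow_add hy, show ga + 1 + (-ga - 1) = 0 by ring, Real.rpow_zero]
    have f3 : y ^ ga * y ^ (-m) = y ^ al := by
      rw [← Real.rpow_add hy]; congr 1; linarith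
    have f4 : y ^ ga * y ^ (-ga) = 1 := by
      rw [← Real.rpow_add hy, show ga + -ga = 0 by ring, Real.rpow_zero]
    simp only [hF]
    linear_combination c * m * f1 + a * ga * f2 - (m + be) * c * f3 - (m + be) * a * f4 + a * hga
  have hle : a * (be - al) ≤ F y0 := by
    refine le_of_tendsto hlim ?_
    filter_upwards [eventually_ge_atTop y0] with y hy
    exact hanti hy0 (lt_of_lt_of_le hy0 hy) hy
  by_contra h
  push Not at h
  have := mul_nonneg h hbe.le
  linarith

/-- **Strict negativity of the second expansion coefficient of the ground state**
(Lemma A.1): if `a₁` is the coefficient in the asymptotic expansion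
`∂_y^k Q = ∂_y^k [c_∞ y^{-2/(p-1)} + a₁ y^{-γ}] + O(y^{-γ-g-k})`
(valid as `y → ∞` for every `k ≥ 0` and every `0 < g < min(α, α₂-α)`), then `a₁ < 0`. -/
theorem a1_strictly_negative (d : ℕ) (hd : 11 ≤ d) (p : ℝ) (hp1 : 1 < p)
    (hp : pJL d < p) (Q : ℝ → ℝ) (hQ : IsGroundState d p Q) (a₁ : ℝ)
    (hexp : ∀ g : ℝ, 0 < g → g < min (alph d p) (alph₂ d p - alph d p) → ∀ k : ℕ,
      (fun y : ℝ => iteratedDeriv k Q y -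
          iteratedDeriv k
            (fun z : ℝ => cInfty d p * z ^ (-(2 / (p - 1))) + a₁ * z ^ (-(gam d p))) y)
        =O[atTop] fun y : ℝ => y ^ (-(gam d p) - g - (k : ℝ))) :
    a₁ < 0 := by
  obtain ⟨hc, hcp, hal, hbe, hgam⟩ := params d hd p hp1 hp
  have hp0 : 0 < p - 1 := by linarith
  obtain ⟨g, hg0, hg⟩ := exists_between (lt_min hal hbe)
  have h0 := hexp g hg0 hg 0
  have h1 := hexp g hg0 hg 1
  simp only [iteratedDeriv_zero, iteratedDeriv_one, Nat.cast_zero, Nat.cast_one, sub_zero] at h0 h1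
  have hmp : 2 / (p - 1) * (p - 1) = 2 := by field_simp
  have hga : gam d p = alph d p + 2 / (p - 1) := by unfold alph; ring
  have hab : alph d p + alph₂ d p = (d : ℝ) - 2 - 2 * (2 / (p - 1)) := by unfold alph₂; ring
  have hgg : (2 / (p - 1) + alph₂ d p) * gam d p = p * cInfty d p ^ (p - 1) := by
    rw [← hgam]; linear_combination gam d p * (hab + hga)
  refine core d p (2 / (p - 1)) (cInfty d p) (alph d p) (alph₂ d p) (gam d p) a₁ g Q hQ.smooth
    hQ.pos hQ.ode hp1 (by positivity) hmp hc hal hbe hga hab hgg ?_ hg0 h0 ?_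
  · generalize 2 / (p - 1) = m at *
    generalize cInfty d p ^ (p - 1) = K at *
    linear_combination hgg - (m + alph₂ d p) * hga - m * hab + hcp
  · refine h1.congr' ?_ EventuallyEq.rfl
    filter_upwards [eventually_gt_atTop 0] with y hy
    congr 1
    exact (((Real.hasDerivAt_rpow_const (x := y) (p := -(2 / (p - 1))) (Or.inl hy.ne')).const_mul (cInfty d p)).add
      ((Real.hasDerivAt_rpow_const (x := y) (p := -(gam d p)) (Or.inl hy.ne')).const_mul a₁)).deriv


end WaveBlowup
end
end

section
/- Hardy inequalities with best constants for radial functions: let d ≥ 3. (i) For every radial u with u ∈ H¹ on every annulus {r ≤ |x| ≤ 1}, 0 < r < 1: ∫_0^1 |∂_y u|²·y^{d−1}dy ≥ ((d−2)²/4)·∫_0^1 (u²/y²)·y^{d−1}dy − C(d)·u(1)² (both sides possibly infinite). (ii) Supercritical weights: for real p > (d−2)/2 and u ∈ H¹ on every annulus {1 ≤ |x| ≤ R}: ∫_1^∞ (|∂_y u|²/y^{2p})·y^{d−1}dy ≥ ((d−2p−2)/2)²·∫_1^∞ (u²/y^{2p+2})·y^{d−1}dy − C(d,p)·u(1)²,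 and for every R > 1, ((2p+2−d)²/4)·∫_1^R (u²/y^{2p+2})·y^{d−1}dy ≤ ∫_1^R (|∂_y u|²/y^{2p})·y^{d−1}dy + C(d,p)·u(1)². (iii) Subcritical weights: for 0 < p < (d−2)/2, if ∫_1^∞ (u²/y^{2p+2})·y^{d−1}dy < ∞ then ∫_1^∞ (|∂_y u|²/y^{2p})·y^{d−1}dy ≥ ((d−2p−2)/2)²·∫_1^∞ (u²/y^{2p+2})·y^{d−1}dy. -/
noncomputable section

open Real MeasureTheory Filter Set Topology ENNReal

namespace WaveBlowup

lemma lim_aux {f g : ℝ → ℝ≥0∞} {s : Set ℝ} {l : Filter ℝ} [l.IsCountablyGenerated]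
    {φ : ℝ → Set ℝ} (hs : MeasurableSet s) (hφ : AECover (volume.restrict s) l φ)
    (hf : AEMeasurable f (volume.restrict s)) {c B : ℝ≥0∞} (hc : c ≠ ⊤)
    (h : ∃ᶠ i in l, φ i ⊆ s ∧ c * (∫⁻ y in φ i, f y) ≤ (∫⁻ y in φ i, g y) + B) :
    c * (∫⁻ y in s, f y) ≤ (∫⁻ y in s, g y) + B := by
  have h1 := hφ.lintegral_tendsto_of_countably_generated hf
  have h2 := ENNReal.Tendsto.const_mul (a := c) h1 (Or.inr hc)
  refine le_of_tendsto_of_frequently h2 (h.mono ?_)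
  rintro i ⟨hi, hle⟩
  rw [Measure.restrict_restrict (hφ.measurableSet i), inter_eq_left.2 hi]
  refine hle.trans ?_
  gcongr

lemma core_s14 (a r R B : ℝ) (hr : 0 < r) (hrR : r < R) (u : ℝ → ℝ)
    (hu : DifferentiableOn ℝ u (Ioi 0))
    (hB : (a / 2) * (R ^ a * u R ^ 2 - r ^ a * u r ^ 2) ≤ B) :
    ENNReal.ofReal (a ^ 2 / 4) * (∫⁻ y in Ioo r R, ENNReal.ofReal (u y ^ 2 * y ^ (a - 1))) ≤
      (∫⁻ y in Ioo r R, ENNReal.ofReal (deriv u y ^ 2 * y ^ (a + 1))) + ENNReal.ofReal B := by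
  by_cases hfin : (∫⁻ y in Ioo r R, ENNReal.ofReal (deriv u y ^ 2 * y ^ (a + 1))) = ⊤
  · simp [hfin]
  have hsub : Icc r R ⊆ Ioi 0 := fun x hx => lt_of_lt_of_le hr hx.1
  have hcu : ContinuousOn u (Icc r R) := hu.continuousOn.mono hsub
  have hpow : ∀ b : ℝ, ContinuousOn (fun y : ℝ => y ^ b) (Icc r R) := fun b y hy =>
    (Real.continuousAt_rpow_const y b (Or.inl (ne_of_gt (hsub hy)))).continuousWithinAt
  have hI1 : IntegrableOn (fun y => u y ^ 2 * y ^ (a - 1)) (Icc r R) :=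
    ((hcu.pow 2).mul (hpow _)).integrableOn_Icc
  have hI1' := hI1.mono_set (Ioo_subset_Icc_self)
  have hm : Measurable (fun y => deriv u y ^ 2 * y ^ (a + 1)) := by
    have := measurable_deriv u
    fun_prop
  have hnn1 : 0 ≤ᵐ[volume.restrict (Ioo r R)] (fun y => u y ^ 2 * y ^ (a - 1)) := by
    filter_upwards [ae_restrict_mem measurableSet_Ioo] with y hy
    have : 0 < y := hr.trans hy.1
    show 0 ≤ u y ^ 2 * y ^ (a - 1)
    positivity
  have hnn2 : 0 ≤ᵐ[volume.restrict (Ioo r R)] (fun y => deriv u y ^ 2 * y ^ (a + 1)) := by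
    filter_upwards [ae_restrict_mem measurableSet_Ioo] with y hy
    have : 0 < y := hr.trans hy.1
    show 0 ≤ deriv u y ^ 2 * y ^ (a + 1)
    positivity
  have hI2' : IntegrableOn (fun y => deriv u y ^ 2 * y ^ (a + 1)) (Ioo r R) :=
    ⟨hm.aestronglyMeasurable, (hasFiniteIntegral_iff_ofReal hnn2).2 (lt_top_iff_ne_top.2 hfin)⟩
  have hI2 : IntegrableOn (fun y => deriv u y ^ 2 * y ^ (a + 1)) (Icc r R) :=
    (integrableOn_Icc_iff_integrableOn_Ioo).2 hI2'
  have key := intervalIntegral.sub_le_integral_of_hasDeriv_right_of_le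
    (g := fun y => -(a / 2) * (y ^ a * u y ^ 2))
    (g' := fun y => -(a / 2) * (a * y ^ (a - 1) * u y ^ 2 + y ^ a * (2 * u y * deriv u y)))
    (φ := fun y => deriv u y ^ 2 * y ^ (a + 1) - a ^ 2 / 4 * (u y ^ 2 * y ^ (a - 1)))
    hrR.le (continuousOn_const.mul ((hpow a).mul (hcu.pow 2)))
    (fun y hy => by
      have hy0 : 0 < y := hr.trans hy.1
      have h1 : HasDerivAt u (deriv u y) y :=
        (hu.differentiableAt (Ioi_mem_nhds hy0)).hasDerivAt
      have h2 := Real.hasDerivAt_rpow_const (x := y) (p := a) (Or.inl hy0.ne')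
      have h3 := ((h2.fun_mul (h1.fun_pow 2)).const_mul (-(a / 2)))
      refine (h3.congr_deriv ?_).hasDerivWithinAt
      push_cast
      ring)
    (hI2.sub (hI1.const_mul _))
    (fun y hy => by
      have hy0 : 0 < y := hr.trans hy.1
      have e1 : y ^ a = y ^ (a - 1) * y := by
        rw [← Real.rpow_add_one hy0.ne']; congr 1; ring
      have e2 : y ^ (a + 1) = y ^ (a - 1) * y * y := by
        rw [Real.rpow_add_one hy0.ne', e1]
      have hp : 0 ≤ y ^ (a - 1) := by positivity
      simp only [e1, e2]
      have := mul_nonneg hp (sq_nonneg (deriv u y * y + a / 2 * u y))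
      nlinarith)
  rw [intervalIntegral.integral_of_le hrR.le, integral_Ioc_eq_integral_Ioo,
    integral_sub hI2' (hI1'.const_mul _), integral_const_mul] at key
  rw [← ofReal_integral_eq_lintegral_ofReal hI1' hnn1,
    ← ofReal_integral_eq_lintegral_ofReal hI2' hnn2, ← ENNReal.ofReal_mul (by positivity)]
  refine (ENNReal.ofReal_le_ofReal ?_).trans ENNReal.ofReal_add_le
  linarith

lemma meas_aux (a : ℝ) (u : ℝ → ℝ) (hu : DifferentiableOn ℝ u (Ioi 0)) (s : Set ℝ)
    (hs : s ⊆ Ioi 0) :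
    AEMeasurable (fun y => ENNReal.ofReal (u y ^ 2 * y ^ (a - 1))) (volume.restrict s) := by
  have h : AEMeasurable u (volume.restrict s) :=
    (hu.continuousOn.aemeasurable measurableSet_Ioi).mono_measure (Measure.restrict_mono hs le_rfl)
  have h2 : Measurable (fun y : ℝ => y ^ (a - 1)) := by fun_prop
  exact ((h.pow_const 2).mul h2.aemeasurable).ennreal_ofReal

lemma cover1 : AECover (volume.restrict (Ioi (1 : ℝ))) atTop (fun R : ℝ => Ioo 1 R) where
  ae_eventually_mem := by
    filter_upwards [ae_restrict_mem measurableSet_Ioi] with y hy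
    filter_upwards [eventually_gt_atTop y] with R hR
    exact ⟨hy, hR⟩
  measurableSet _ := measurableSet_Ioo

lemma cover0 : AECover (volume.restrict (Ioo (0 : ℝ) 1)) (𝓝[>] 0) (fun r : ℝ => Ioo r 1) where
  ae_eventually_mem := by
    filter_upwards [ae_restrict_mem measurableSet_Ioo] with y hy
    filter_upwards [mem_nhdsWithin_of_mem_nhds (Iio_mem_nhds hy.1)] with R hR
    exact ⟨hR, hy.2⟩
  measurableSet _ := measurableSet_Ioo

lemma freq (a ε : ℝ) (hε : 0 < ε) (u : ℝ → ℝ)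
    (h : (∫⁻ y in Ioi (1:ℝ), ENNReal.ofReal (u y ^ 2 * y ^ (a - 1))) < ⊤) :
    ∃ᶠ R in atTop, R ^ a * u R ^ 2 ≤ ε := by
  intro hev
  obtain ⟨M, hM⟩ := eventually_atTop.1 hev
  push Not at hM
  set N := max M 1
  refine not_integrableOn_Ioi_inv (a := N) ?_
  have h1N : 1 ≤ N := le_max_right _ _
  refine ⟨measurable_inv.aestronglyMeasurable, ?_⟩
  have hnn : 0 ≤ᵐ[volume.restrict (Ioi N)] (fun y : ℝ => y⁻¹) := by
    filter_upwards [ae_restrict_mem measurableSet_Ioi] with y hy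
    have : N < y := hy
    show 0 ≤ y⁻¹
    exact inv_nonneg.2 (by linarith)
  rw [hasFiniteIntegral_iff_ofReal hnn]
  have hlt : ENNReal.ofReal ε⁻¹ *
      (∫⁻ y in Ioi (1:ℝ), ENNReal.ofReal (u y ^ 2 * y ^ (a - 1))) < ⊤ :=
    ENNReal.mul_lt_top ENNReal.ofReal_lt_top h
  refine lt_of_le_of_lt ?_ hlt
  rw [← lintegral_const_mul' _ _ ENNReal.ofReal_ne_top]
  refine le_trans ?_ (lintegral_mono_set (Ioi_subset_Ioi h1N))
  refine setLIntegral_mono' measurableSet_Ioi fun y hy => ?_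
  have hy' : N < y := hy
  have hy0 : 0 < y := by linarith
  rw [← ENNReal.ofReal_mul (by positivity)]
  refine ENNReal.ofReal_le_ofReal ?_
  have hh := hM y ((le_max_left _ _).trans hy'.le)
  rw [Real.rpow_sub_one hy0.ne', inv_mul_eq_div, le_div_iff₀ hε]
  have e : u y ^ 2 * (y ^ a / y) = y⁻¹ * (y ^ a * u y ^ 2) := by
    field_simp
  rw [e]
  gcongr

lemma conv_u (d : ℕ) (hd : 3 ≤ d) (p x y : ℝ) (hy : 0 < y) :
    x / y ^ (2 * p + 2) * y ^ (d - 1) = x * y ^ (((d : ℝ) - 2 * p - 2) - 1) := by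
  have : y ^ (d - 1) = y ^ ((d : ℝ) - 1) := by
    rw [← Real.rpow_natCast, Nat.cast_sub (by omega)]; simp
  rw [this, div_mul_eq_mul_div, mul_div_assoc, ← Real.rpow_sub hy]
  congr 2; ring

lemma conv_v (d : ℕ) (hd : 3 ≤ d) (p x y : ℝ) (hy : 0 < y) :
    x / y ^ (2 * p) * y ^ (d - 1) = x * y ^ (((d : ℝ) - 2 * p - 2) + 1) := by
  have : y ^ (d - 1) = y ^ ((d : ℝ) - 1) := by
    rw [← Real.rpow_natCast, Nat.cast_sub (by omega)]; simp
  rw [this, div_mul_eq_mul_div, mul_div_assoc, ← Real.rpow_sub hy]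
  congr 2; ring

lemma int_u (d : ℕ) (hd : 3 ≤ d) (p : ℝ) (u : ℝ → ℝ) (s : Set ℝ) (hm : MeasurableSet s)
    (hs : s ⊆ Ioi 0) :
    (∫⁻ y in s, ENNReal.ofReal ((u y) ^ 2 / y ^ (2 * p + 2) * y ^ (d - 1))) =
      ∫⁻ y in s, ENNReal.ofReal (u y ^ 2 * y ^ (((d : ℝ) - 2 * p - 2) - 1)) :=
  setLIntegral_congr_fun hm fun y hy => by
    show ENNReal.ofReal _ = ENNReal.ofReal _
    rw [conv_u d hd p _ y (hs hy)]

lemma int_v (d : ℕ) (hd : 3 ≤ d) (p : ℝ) (u : ℝ → ℝ) (s : Set ℝ) (hm : MeasurableSet s)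
    (hs : s ⊆ Ioi 0) :
    (∫⁻ y in s, ENNReal.ofReal ((u y) ^ 2 / y ^ (2 * p) * y ^ (d - 1))) =
      ∫⁻ y in s, ENNReal.ofReal (u y ^ 2 * y ^ (((d : ℝ) - 2 * p - 2) + 1)) :=
  setLIntegral_congr_fun hm fun y hy => by
    show ENNReal.ofReal _ = ENNReal.ofReal _
    rw [conv_v d hd p _ y (hs hy)]

/-- **Hardy inequalities with best constants for radial functions** (Lemma C.1), for
`d ≥ 3`, with the radial measure `y^{d-1} dy` and all quantities possibly infinite:
(i) near the origin, `∫_0^1 |∂_y u|² y^{d-1} ≥ ((d-2)²/4) ∫_0^1 (u²/y²) y^{d-1} - C(d) u(1)²`;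
(ii) for a supercritical weight `p > (d-2)/2`,
`∫_1^∞ (|∂_y u|²/y^{2p}) y^{d-1} ≥ ((d-2p-2)/2)² ∫_1^∞ (u²/y^{2p+2}) y^{d-1} - C(d,p) u(1)²`
together with the truncated version on `(1,R)` for every `R > 1`;
(iii) for a subcritical weight `0 < p < (d-2)/2`, under the integrability condition
`∫_1^∞ (u²/y^{2p+2}) y^{d-1} < ∞`, the same inequality holds without boundary term. -/
theorem hardy_inequalities (d : ℕ) (hd : 3 ≤ d) :
    -- (i) Hardy near the origin
    (∃ C : ℝ, 0 < C ∧ ∀ u : ℝ → ℝ, DifferentiableOn ℝ u (Ioi 0) →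
      ENNReal.ofReal (((d : ℝ) - 2) ^ 2 / 4) *
          (∫⁻ y in Ioo (0:ℝ) 1, ENNReal.ofReal ((u y) ^ 2 / y ^ 2 * y ^ (d - 1))) ≤
        (∫⁻ y in Ioo (0:ℝ) 1, ENNReal.ofReal ((deriv u y) ^ 2 * y ^ (d - 1))) +
          ENNReal.ofReal (C * (u 1) ^ 2)) ∧
    -- (ii) Hardy away from the origin, supercritical weight
    (∀ pw : ℝ, ((d : ℝ) - 2) / 2 < pw →
      ∃ C : ℝ, 0 < C ∧ ∀ u : ℝ → ℝ, DifferentiableOn ℝ u (Ioi 0) →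
        (ENNReal.ofReal ((((d : ℝ) - 2 * pw - 2) / 2) ^ 2) *
            (∫⁻ y in Ioi (1:ℝ), ENNReal.ofReal ((u y) ^ 2 / y ^ (2 * pw + 2) * y ^ (d - 1))) ≤
          (∫⁻ y in Ioi (1:ℝ), ENNReal.ofReal ((deriv u y) ^ 2 / y ^ (2 * pw) * y ^ (d - 1))) +
            ENNReal.ofReal (C * (u 1) ^ 2)) ∧
        (∀ R : ℝ, 1 < R →
          ENNReal.ofReal ((2 * pw + 2 - (d : ℝ)) ^ 2 / 4) *
              (∫⁻ y in Ioo (1:ℝ) R, ENNReal.ofReal ((u y) ^ 2 / y ^ (2 * pw + 2) * y ^ (d - 1))) ≤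
            (∫⁻ y in Ioo (1:ℝ) R, ENNReal.ofReal ((deriv u y) ^ 2 / y ^ (2 * pw) * y ^ (d - 1))) +
              ENNReal.ofReal (C * (u 1) ^ 2))) ∧
    -- (iii) Hardy away from the origin, subcritical weight
    (∀ pw : ℝ, 0 < pw → pw < ((d : ℝ) - 2) / 2 →
      ∀ u : ℝ → ℝ, DifferentiableOn ℝ u (Ioi 0) →
        (∫⁻ y in Ioi (1:ℝ), ENNReal.ofReal ((u y) ^ 2 / y ^ (2 * pw + 2) * y ^ (d - 1))) < ⊤ →
        ENNReal.ofReal ((((d : ℝ) - 2 * pw - 2) / 2) ^ 2) *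
            (∫⁻ y in Ioi (1:ℝ), ENNReal.ofReal ((u y) ^ 2 / y ^ (2 * pw + 2) * y ^ (d - 1))) ≤
          ∫⁻ y in Ioi (1:ℝ), ENNReal.ofReal ((deriv u y) ^ 2 / y ^ (2 * pw) * y ^ (d - 1))) := by
  have hd' : (3 : ℝ) ≤ d := by exact_mod_cast hd
  have hI1 : Ioi (1 : ℝ) ⊆ Ioi 0 := Ioi_subset_Ioi zero_le_one
  refine ⟨⟨((d : ℝ) - 2) / 2, by linarith, fun u hu => ?_⟩, fun p hp =>
    ⟨(2 * p + 2 - d) / 2, by linarith, fun u hu => ?_⟩, fun p hp0 hp u hu hfin => ?_⟩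
  · have hs : Ioo (0 : ℝ) 1 ⊆ Ioi 0 := Ioo_subset_Ioi_self
    have e1 := int_u d hd 0 u _ measurableSet_Ioo hs
    have e2 := int_v d hd 0 (deriv u) _ measurableSet_Ioo hs
    have e0 : (2 * (0 : ℝ) + 2) = (2 : ℕ) := by norm_num
    simp only [e0, Real.rpow_natCast] at e1
    simp only [mul_zero, Real.rpow_zero, div_one] at e2
    simp only [mul_zero] at e1
    rw [e1, e2, sub_zero]
    refine lim_aux measurableSet_Ioo cover0 (meas_aux _ u hu _ hs) ENNReal.ofReal_ne_top
      (Eventually.frequently ?_)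
    filter_upwards [self_mem_nhdsWithin, mem_nhdsWithin_of_mem_nhds (Iio_mem_nhds one_pos)]
      with r hr hr1
    have hr : 0 < r := hr
    refine ⟨Ioo_subset_Ioo_left hr.le, core_s14 _ r 1 _ hr hr1 u hu ?_⟩
    rw [Real.one_rpow, one_mul]
    have : 0 ≤ r ^ ((d : ℝ) - 2) * u r ^ 2 := by positivity
    gcongr
    · linarith
    · linarith
  · have hR : ∀ R : ℝ, 1 < R → ENNReal.ofReal (((d : ℝ) - 2 * p - 2) ^ 2 / 4) *
        (∫⁻ y in Ioo 1 R, ENNReal.ofReal (u y ^ 2 * y ^ (((d : ℝ) - 2 * p - 2) - 1))) ≤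
        (∫⁻ y in Ioo 1 R, ENNReal.ofReal (deriv u y ^ 2 * y ^ (((d : ℝ) - 2 * p - 2) + 1))) +
        ENNReal.ofReal ((2 * p + 2 - d) / 2 * u 1 ^ 2) := by
      intro R hR
      refine core_s14 _ 1 R _ one_pos hR u hu ?_
      rw [Real.one_rpow, one_mul]
      have h0 : 0 < R := by linarith
      have h1 : 0 ≤ R ^ ((d : ℝ) - 2 * p - 2) * u R ^ 2 := by positivity
      have h2 : 0 ≤ (2 * p + 2 - d) / 2 := by linarith
      have := mul_nonneg h2 h1
      nlinarith
    constructor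
    · rw [int_u d hd p u _ measurableSet_Ioi hI1, int_v d hd p _ _ measurableSet_Ioi hI1]
      rw [div_pow, show (2 : ℝ) ^ 2 = 4 by norm_num]
      refine lim_aux measurableSet_Ioi cover1 (meas_aux _ u hu _ hI1) ENNReal.ofReal_ne_top
        (Eventually.frequently ?_)
      filter_upwards [eventually_gt_atTop 1] with R h1
      exact ⟨Ioo_subset_Ioi_self, hR R h1⟩
    · intro R h1
      have hs : Ioo (1 : ℝ) R ⊆ Ioi 0 := Ioo_subset_Ioi_self.trans hI1
      rw [int_u d hd p u _ measurableSet_Ioo hs, int_v d hd p _ _ measurableSet_Ioo hs,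
        show (2 * p + 2 - (d : ℝ)) ^ 2 = ((d : ℝ) - 2 * p - 2) ^ 2 by ring]
      exact hR R h1
  · rw [int_u d hd p u _ measurableSet_Ioi hI1] at hfin ⊢
    rw [int_v d hd p _ _ measurableSet_Ioi hI1, div_pow, show (2 : ℝ) ^ 2 = 4 by norm_num]
    refine ENNReal.le_of_forall_pos_le_add fun ε hε _ => ?_
    have ha : 0 < ((d : ℝ) - 2 * p - 2) / 2 := by linarith
    have hε' : (0 : ℝ) < ε := hε
    rw [← ENNReal.ofReal_coe_nnreal]
    refine lim_aux measurableSet_Ioi cover1 (meas_aux _ u hu _ hI1) ENNReal.ofReal_ne_top ?_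
    refine ((freq _ (ε / (((d : ℝ) - 2 * p - 2) / 2)) (by positivity) u hfin).and_eventually
      (eventually_gt_atTop 1)).mono ?_
    rintro R ⟨h1, h2⟩
    refine ⟨Ioo_subset_Ioi_self, core_s14 _ 1 R _ one_pos h2 u hu ?_⟩
    rw [Real.one_rpow, one_mul]
    rw [le_div_iff₀ ha] at h1
    have := mul_nonneg ha.le (sq_nonneg (u 1))
    nlinarith

end WaveBlowup
end
end

section
/- Equivalence of weighted adapted norms: let d ≥ 11, p > p_JL. For every integer k there exists a constant c = c(d,p,k) ≥ 1 such that for every C^∞ radial function u on ℝ^d, (1/c)·Σ_{i=0}^{k}∫ |D^i u|²/(1+y^{2k−2i}) ≤ Σ_{i=0}^{k}∫ u_i²/(1+y^{2k−2i}) ≤ c·Σ_{i=0}^{k}∫ |D^i u|²/(1+y^{2k−2i}), where all integrals are over ℝ^d and the quantities need not be finite; here D^{2j}u := Δ^j u, D^{2j+1}u := ∂_y Δ^j u, and u_i denotes the i-th adapted derivative of u. -/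
noncomputable section

open Real MeasureTheory Filter Asymptotics Set Topology ENNReal

namespace WaveBlowup

/-- Laplace-based derivatives of a radial function: `D^{2j}u = Δ^j u`,
`D^{2j+1}u = ∂_y Δ^j u`, where `Δ = ∂_yy + (d-1)/y ∂_y` is the radial Laplacian. -/
def Dop (d : ℕ) : ℕ → (ℝ → ℝ) → (ℝ → ℝ)
  | 0, u => u
  | (n+1), u => if n % 2 = 0 then deriv (Dop d n u)
      else fun y => deriv (Dop d n u) y + ((d : ℝ) - 1) / y * Dop d n u y

/-- Symbol class of finite order on a set `I`, relative to the derivation `f ↦ f'/y`. -/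
def SymN (I : Set ℝ) : ℕ → ℤ → (ℝ → ℝ) → Prop
  | 0, m, f => ∃ C : ℝ, ∀ y ∈ I, |f y| ≤ C * (1 + y) ^ m
  | (n+1), m, f => (∃ C : ℝ, ∀ y ∈ I, |f y| ≤ C * (1 + y) ^ m) ∧
      (∀ y ∈ I, DifferentiableAt ℝ f y) ∧ SymN I n (m - 2) (fun y => deriv f y / y)

theorem SymN.bd {I : Set ℝ} {n : ℕ} {m : ℤ} {f : ℝ → ℝ} (h : SymN I n m f) :
    ∃ C : ℝ, ∀ y ∈ I, |f y| ≤ C * (1 + y) ^ m := by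
  cases n with
  | zero => exact h
  | succ n => exact h.1

theorem SymN.congr {I : Set ℝ} (hI : IsOpen I) {n : ℕ} {m : ℤ} {f g : ℝ → ℝ}
    (h : SymN I n m f) (e : ∀ y ∈ I, f y = g y) : SymN I n m g := by
  induction n generalizing m f g with
  | zero =>
    obtain ⟨C, hC⟩ := h
    exact ⟨C, fun y hy => by rw [← e y hy]; exact hC y hy⟩
  | succ n ih =>
    obtain ⟨⟨C, hC⟩, hd, hs⟩ := h
    have ee : ∀ y ∈ I, f =ᶠ[𝓝 y] g := fun y hy => by
      filter_upwards [hI.mem_nhds hy] with z hz using e z hz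
    refine ⟨⟨C, fun y hy => by rw [← e y hy]; exact hC y hy⟩,
      fun y hy => (hd y hy).congr_of_eventuallyEq (ee y hy).symm, ih hs ?_⟩
    intro y hy
    simp only [(ee y hy).deriv_eq]

theorem SymN.intro {I : Set ℝ} (hI : IsOpen I) (hp : ∀ y ∈ I, 0 < y) {n : ℕ} {m : ℤ}
    {f g : ℝ → ℝ} (hb : ∃ C : ℝ, ∀ y ∈ I, |f y| ≤ C * (1 + y) ^ m)
    (hd : ∀ y ∈ I, HasDerivAt f (y * g y) y) (hg : SymN I n (m - 2) g) :
    SymN I (n+1) m f := by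
  refine ⟨hb, fun y hy => (hd y hy).differentiableAt, hg.congr hI ?_⟩
  intro y hy
  have := hp y hy
  simp only [(hd y hy).deriv]
  field_simp

theorem SymN.der {I : Set ℝ} (hp : ∀ y ∈ I, 0 < y) {n : ℕ} {m : ℤ}
    {f : ℝ → ℝ} (h : SymN I (n+1) m f) :
    ∀ y ∈ I, HasDerivAt f (y * (deriv f y / y)) y := by
  intro y hy
  have := hp y hy
  have e : y * (deriv f y / y) = deriv f y := by field_simp
  rw [e]
  exact (h.2.1 y hy).hasDerivAt

theorem SymN.pred {I : Set ℝ} {n : ℕ} {m : ℤ}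
    {f : ℝ → ℝ} (h : SymN I (n+1) m f) : SymN I n m f := by
  induction n generalizing m f with
  | zero => exact h.1
  | succ n ih => exact ⟨h.1, h.2.1, ih h.2.2⟩

theorem bd_add {I : Set ℝ} {m : ℤ} {f g : ℝ → ℝ}
    (hf : ∃ C : ℝ, ∀ y ∈ I, |f y| ≤ C * (1 + y) ^ m)
    (hg : ∃ C : ℝ, ∀ y ∈ I, |g y| ≤ C * (1 + y) ^ m) :
    ∃ C : ℝ, ∀ y ∈ I, |f y + g y| ≤ C * (1 + y) ^ m := by
  obtain ⟨C, hC⟩ := hf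
  obtain ⟨D, hD⟩ := hg
  refine ⟨C + D, fun y hy => (abs_add_le _ _).trans ?_⟩
  rw [add_mul]
  exact add_le_add (hC y hy) (hD y hy)

theorem bd_mul {I : Set ℝ} (hp : ∀ y ∈ I, 0 < y) {m m' : ℤ} {f g : ℝ → ℝ}
    (hf : ∃ C : ℝ, ∀ y ∈ I, |f y| ≤ C * (1 + y) ^ m)
    (hg : ∃ C : ℝ, ∀ y ∈ I, |g y| ≤ C * (1 + y) ^ m') :
    ∃ C : ℝ, ∀ y ∈ I, |f y * g y| ≤ C * (1 + y) ^ (m + m') := by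
  obtain ⟨C, hC⟩ := hf
  obtain ⟨D, hD⟩ := hg
  refine ⟨C * D, fun y hy => ?_⟩
  have := hp y hy
  rw [abs_mul, zpow_add₀ (by positivity)]
  calc |f y| * |g y| ≤ (C * (1 + y) ^ m) * (D * (1 + y) ^ m') :=
        mul_le_mul (hC y hy) (hD y hy) (abs_nonneg _) ((abs_nonneg _).trans (hC y hy))
    _ = _ := by ring

theorem SymN.add {I : Set ℝ} (hI : IsOpen I) (hp : ∀ y ∈ I, 0 < y) {n : ℕ} {m : ℤ}
    {f g : ℝ → ℝ} (hf : SymN I n m f) (hg : SymN I n m g) :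
    SymN I n m (fun y => f y + g y) := by
  induction n generalizing m f g with
  | zero => exact bd_add hf hg
  | succ n ih =>
    refine SymN.intro hI hp (bd_add hf.bd hg.bd) (g := fun y => deriv f y / y + deriv g y / y)
      (fun y hy => ?_) (ih hf.2.2 hg.2.2)
    rw [mul_add]
    exact (hf.der hp y hy).add (hg.der hp y hy)

theorem SymN.mul {I : Set ℝ} (hI : IsOpen I) (hp : ∀ y ∈ I, 0 < y) {n : ℕ} {m m' : ℤ}
    {f g : ℝ → ℝ} (hf : SymN I n m f) (hg : SymN I n m' g) :
    SymN I n (m + m') (fun y => f y * g y) := by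
  induction n generalizing m m' f g with
  | zero => exact bd_mul hp hf hg
  | succ n ih =>
    refine SymN.intro hI hp (bd_mul hp hf.bd hg.bd)
      (g := fun y => deriv f y / y * g y + f y * (deriv g y / y))
      (fun y hy => ?_) (SymN.add hI hp ?_ ?_)
    · refine ((hf.der hp y hy).mul (hg.der hp y hy)).congr_deriv ?_
      ring
    · have := ih hf.2.2 hg.pred
      rwa [show m - 2 + m' = m + m' - 2 by ring] at this
    · have := ih hf.pred hg.2.2
      rwa [show m + (m' - 2) = m + m' - 2 by ring] at this

theorem SymN.zero {I : Set ℝ} (hI : IsOpen I) (hp : ∀ y ∈ I, 0 < y) (n : ℕ) (m : ℤ) :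
    SymN I n m (fun _ => 0) := by
  induction n generalizing m with
  | zero => exact ⟨0, fun y hy => by simp⟩
  | succ n ih =>
    exact SymN.intro hI hp ⟨0, fun y hy => by simp⟩ (g := fun _ => 0)
      (fun y hy => by simpa using hasDerivAt_const y (0:ℝ)) (ih _)

theorem SymN.const {I : Set ℝ} (hI : IsOpen I) (hp : ∀ y ∈ I, 0 < y) (n : ℕ) (c : ℝ) :
    SymN I n 0 (fun _ => c) := by
  cases n with
  | zero => exact ⟨|c|, fun y hy => by simp⟩
  | succ n =>
    exact SymN.intro hI hp ⟨|c|, fun y hy => by simp⟩ (g := fun _ => 0)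
      (fun y hy => by simpa using hasDerivAt_const y c) (SymN.zero hI hp _ _)

theorem SymN.cmul {I : Set ℝ} (hI : IsOpen I) (hp : ∀ y ∈ I, 0 < y) {n : ℕ} {m : ℤ}
    {f : ℝ → ℝ} (hf : SymN I n m f) (c : ℝ) : SymN I n m (fun y => c * f y) := by
  have := (SymN.const hI hp n c).mul hI hp hf
  rwa [zero_add] at this

theorem SymN.sq {I : Set ℝ} (hI : IsOpen I) (hp : ∀ y ∈ I, 0 < y) (n : ℕ) :
    SymN I n 2 (fun y => y ^ 2) := by
  have hb : ∃ C : ℝ, ∀ y ∈ I, |y ^ 2| ≤ C * (1 + y) ^ (2:ℤ) := by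
    refine ⟨1, fun y hy => ?_⟩
    have := hp y hy
    rw [abs_of_pos (by positivity), one_mul]
    norm_cast
    gcongr
    linarith
  cases n with
  | zero => exact hb
  | succ n =>
    refine SymN.intro hI hp hb (g := fun _ => 2) (fun y hy => ?_)
      (SymN.const hI hp n 2)
    refine (hasDerivAt_pow 2 y).congr_deriv ?_
    push_cast
    ring

theorem SymN.rpow {I : Set ℝ} (hI : IsOpen I) (hp : ∀ y ∈ I, 0 < y) {n : ℕ}
    {f : ℝ → ℝ} (hf : SymN I n 0 f) {ε : ℝ} (hε : 0 < ε) (hfe : ∀ y ∈ I, ε ≤ f y) (s : ℝ) :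
    SymN I n 0 (fun y => f y ^ s) := by
  have hb : ∀ s : ℝ, ∃ C : ℝ, ∀ y ∈ I, |f y ^ s| ≤ C * (1 + y) ^ (0:ℤ) := by
    intro s
    obtain ⟨C, hC⟩ := hf.bd
    refine ⟨ε ^ s + |C| ^ s, fun y hy => ?_⟩
    have h1 := hfe y hy
    have h2 := hC y hy
    rw [zpow_zero, mul_one, abs_of_pos (by linarith)] at h2
    have h3 : 0 < f y := by linarith
    have h4 : f y ≤ |C| := h2.trans (le_abs_self _)
    have h5 : 0 < |C| := by linarith
    rw [zpow_zero, mul_one, abs_of_pos (Real.rpow_pos_of_pos h3 _)]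
    have := Real.rpow_pos_of_pos h5 s
    have := Real.rpow_pos_of_pos hε s
    rcases le_total 0 s with hs | hs
    · have := Real.rpow_le_rpow h3.le h4 hs
      linarith
    · have := Real.rpow_le_rpow_of_nonpos hε h1 hs
      linarith
  induction n generalizing s with
  | zero => exact hb s
  | succ n ih =>
    refine SymN.intro hI hp (hb s) (g := fun y => s * (f y ^ (s-1) * (deriv f y / y)))
      (fun y hy => ?_) (SymN.cmul hI hp ?_ s)
    · have h3 : f y ≠ 0 := by linarith [hfe y hy]
      refine ((hf.der hp y hy).rpow_const (p := s) (Or.inl h3)).congr_deriv ?_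
      ring
    · exact (ih hf.pred (s-1)).mul hI hp hf.2.2

theorem SymN.chg {I : Set ℝ} (hI : ∀ y ∈ I, 0 < y ∧ y < 2) {n : ℕ} {m : ℤ} (m' : ℤ)
    {f : ℝ → ℝ} (hf : SymN I n m f) : SymN I n m' f := by
  have key : ∀ (m m' : ℤ) (f : ℝ → ℝ), (∃ C : ℝ, ∀ y ∈ I, |f y| ≤ C * (1 + y) ^ m) →
      ∃ C : ℝ, ∀ y ∈ I, |f y| ≤ C * (1 + y) ^ m' := by
    rintro m m' f ⟨C, hC⟩
    refine ⟨|C| * 3 ^ (m - m').natAbs, fun y hy => (hC y hy).trans ?_⟩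
    obtain ⟨h0, h2⟩ := hI y hy
    have e : (1 + y) ^ m = (1 + y) ^ (m - m') * (1 + y) ^ m' := by
      rw [← zpow_add₀ (by positivity)]
      congr 1
      ring
    rw [e, ← mul_assoc]
    have h5 : (1 + y) ^ (m - m') ≤ (3:ℝ) ^ (m - m').natAbs := by
      calc (1 + y) ^ (m - m') ≤ (1 + y) ^ (((m - m').natAbs : ℕ) : ℤ) := by
            apply zpow_le_zpow_right₀ (by linarith)
            omega
        _ ≤ _ := by
            rw [zpow_natCast]
            gcongr
            linarith
    gcongr
    exact le_abs_self C
  induction n generalizing m m' f with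
  | zero => exact key m m' f hf
  | succ n ih => exact ⟨key m m' f hf.1, hf.2.1, ih _ hf.2.2⟩

theorem SymN.glue {n : ℕ} {m : ℤ} {f : ℝ → ℝ} (h1 : SymN (Ioo 0 2) n m f)
    (h2 : SymN (Ioi 1) n m f) : SymN (Ioi 0) n m f := by
  have key : ∀ (m : ℤ) (f : ℝ → ℝ), (∃ C : ℝ, ∀ y ∈ Ioo (0:ℝ) 2, |f y| ≤ C * (1 + y) ^ m) →
      (∃ C : ℝ, ∀ y ∈ Ioi (1:ℝ), |f y| ≤ C * (1 + y) ^ m) →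
      ∃ C : ℝ, ∀ y ∈ Ioi (0:ℝ), |f y| ≤ C * (1 + y) ^ m := by
    rintro m f ⟨C, hC⟩ ⟨D, hD⟩
    refine ⟨max C D, fun y hy => ?_⟩
    have hy' : 0 < y := hy
    rcases lt_or_ge 1 y with h | h
    · refine (hD y h).trans ?_
      gcongr
      exact le_max_right _ _
    · refine (hC y ⟨hy, by linarith⟩).trans ?_
      gcongr
      exact le_max_left _ _
  induction n generalizing m f with
  | zero => exact key m f h1 h2
  | succ n ih =>
    refine ⟨key m f h1.1 h2.1, fun y hy => ?_, ih h1.2.2 h2.2.2⟩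
    rcases lt_or_ge 1 y with h | h
    · exact h2.2.1 y h
    · exact h1.2.1 y ⟨hy, by linarith⟩

theorem lemZ {n : ℕ} {c : ℕ} (hc : 0 < c) {f h : ℝ → ℝ}
    (hf : ∀ y ∈ Ioo (0:ℝ) 2, HasDerivAt f ((-h y - c * f y) / y) y)
    (hh : SymN (Ioo 0 2) n 0 h)
    (hl : Tendsto (fun y => y ^ c * f y) (𝓝[>] 0) (𝓝 0)) : SymN (Ioo 0 2) n 0 f := by
  have hI : IsOpen (Ioo (0:ℝ) 2) := isOpen_Ioo
  have hp : ∀ y ∈ Ioo (0:ℝ) 2, 0 < y := fun y hy => hy.1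
  have hc' : (0:ℝ) < c := by exact_mod_cast hc
  have hlp : Tendsto (fun y : ℝ => y ^ c) (𝓝[>] 0) (𝓝 0) := by
    have : Tendsto (fun y : ℝ => y ^ c) (𝓝 0) (𝓝 (0 ^ c)) := (continuous_pow c).tendsto 0
    rw [zero_pow hc.ne'] at this
    exact this.mono_left nhdsWithin_le_nhds
  induction n generalizing c f h with
  | zero =>
    obtain ⟨C, hC⟩ := hh
    simp only [zpow_zero, mul_one] at hC
    have key : ∀ σ : ℝ, |σ| = 1 → ∀ y ∈ Ioo (0:ℝ) 2, 0 ≤ C / c * y ^ c + σ * (y ^ c * f y) := by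
      intro σ hσ y hy
      have hder : ∀ y ∈ Ioo (0:ℝ) 2, HasDerivAt (fun y => C / c * y ^ c + σ * (y ^ c * f y))
          (y ^ (c - 1) * (C - σ * h y)) y := by
        intro y hy
        have h0 := hy.1
        have h1 := hasDerivAt_pow c y
        refine ((h1.const_mul (C / c)).add ((h1.mul (hf y hy)).const_mul σ)).congr_deriv ?_
        obtain ⟨e, rfl⟩ : ∃ e, c = e + 1 := ⟨c - 1, by omega⟩
        simp only [Nat.add_sub_cancel]
        field_simp
        ring
      have hm : MonotoneOn (fun y => C / c * y ^ c + σ * (y ^ c * f y)) (Ioo 0 2) := by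
        apply monotoneOn_of_deriv_nonneg (convex_Ioo 0 2)
        · exact fun y hy => (hder y hy).continuousAt.continuousWithinAt
        · rw [interior_Ioo]
          exact fun y hy => (hder y hy).differentiableAt.differentiableWithinAt
        · rw [interior_Ioo]
          intro y hy
          rw [(hder y hy).deriv]
          have h0 := hy.1
          have h2 := hC y hy
          have h3 : σ * h y ≤ |h y| := by
            calc σ * h y ≤ |σ * h y| := le_abs_self _
              _ = |h y| := by rw [abs_mul, hσ, one_mul]
          have : 0 ≤ C - σ * h y := by linarith
          positivity
      have ht : Tendsto (fun y => C / c * y ^ c + σ * (y ^ c * f y)) (𝓝[>] 0) (𝓝 0) := by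
        have := (hlp.const_mul (C / c)).add (hl.const_mul σ)
        simpa using this
      refine le_of_tendsto ht ?_
      filter_upwards [Ioo_mem_nhdsGT hy.1] with z hz
      exact hm ⟨hz.1, hz.2.trans hy.2⟩ hy hz.2.le
    refine ⟨C / c, fun y hy => ?_⟩
    have h0 : 0 < y ^ c := pow_pos hy.1 c
    have k1 := key 1 (by simp) y hy
    have k2 := key (-1) (by simp) y hy
    rw [zpow_zero, mul_one, abs_le]
    constructor
    · by_contra hcon
      push Not at hcon
      nlinarith
    · by_contra hcon
      push Not at hcon
      nlinarith
  | succ n ih =>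
    have hb : SymN (Ioo 0 2) n 0 f := ih hc hf hh.pred hl hc' hlp
    refine SymN.intro hI hp hb.bd (g := fun y => (-h y - c * f y) / y ^ 2) (fun y hy => ?_) ?_
    · refine (hf y hy).congr_deriv ?_
      have := hp y hy
      field_simp
    · refine SymN.chg (fun y hy => hy) _ (m := 0) ?_
      refine ih (c := c + 2) (h := fun y => deriv h y / y) (by omega) ?_
        (SymN.chg (fun y hy => hy) _ hh.2.2) ?_ (by positivity) ?_
      · intro y hy
        have h0 := hp y hy
        refine (((hh.der hp y hy).neg.sub ((hf y hy).const_mul (c:ℝ))).div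
          (hasDerivAt_pow 2 y) (by positivity)).congr_deriv ?_
        simp only [Pi.neg_apply, Pi.sub_apply]
        push_cast
        field_simp
        ring
      · have hb' : Tendsto (fun y => y ^ c * h y) (𝓝[>] 0) (𝓝 0) := by
          obtain ⟨C, hC⟩ := hh.bd
          simp only [zpow_zero, mul_one] at hC
          have h1 : Tendsto (fun y : ℝ => y ^ c * C) (𝓝[>] 0) (𝓝 0) := by
            simpa using hlp.mul_const C
          refine squeeze_zero_norm' ?_ h1
          filter_upwards [Ioo_mem_nhdsGT (show (0:ℝ) < 2 by norm_num)] with y hy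
          have := hy.1
          rw [norm_mul, Real.norm_eq_abs, Real.norm_eq_abs, abs_of_pos (by positivity)]
          exact mul_le_mul_of_nonneg_left (hC y hy) (by positivity)
        have h2 := hb'.neg.sub (hl.const_mul (c:ℝ))
        simp only [neg_zero, mul_zero, sub_zero] at h2
        refine h2.congr' ?_
        filter_upwards [self_mem_nhdsWithin] with y hy
        have : 0 < y := hy
        field_simp
        ring
      · have : Tendsto (fun y : ℝ => y ^ (c+2)) (𝓝 0) (𝓝 (0 ^ (c+2))) :=
          (continuous_pow (c+2)).tendsto 0
        rw [zero_pow (by omega)] at this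
        exact this.mono_left nhdsWithin_le_nhds

theorem antiF {F F' : ℝ → ℝ} (hc : ContinuousOn F (Ici 0))
    (hd : ∀ y, 0 < y → HasDerivAt F (F' y) y) (hn : ∀ y, 0 < y → F' y ≤ 0) :
    AntitoneOn F (Ici 0) := by
  apply antitoneOn_of_deriv_nonpos (convex_Ici 0) hc
  · rw [interior_Ici]
    exact fun y hy => (hd y hy).differentiableAt.differentiableWithinAt
  · rw [interior_Ici]
    intro y hy
    rw [(hd y hy).deriv]
    exact hn y hy

theorem invsq (n : ℕ) : SymN (Ioi 1) n (-2) (fun y => (y ^ 2)⁻¹) := by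
  have hp : ∀ y ∈ Ioi (1:ℝ), 0 < y := fun y hy => zero_lt_one.trans hy
  have hb : ∃ C : ℝ, ∀ y ∈ Ioi (1:ℝ), |(y ^ 2)⁻¹| ≤ C * (1 + y) ^ (-2 : ℤ) := by
    refine ⟨4, fun y hy => ?_⟩
    have := hp y hy
    have h1 : 1 < y := hy
    rw [abs_of_pos (by positivity), zpow_neg]
    norm_cast
    rw [← div_eq_mul_inv, inv_eq_one_div, div_le_div_iff₀ (by positivity) (by positivity)]
    nlinarith
  induction n with
  | zero => exact hb
  | succ n ih =>
    refine SymN.intro isOpen_Ioi hp hb (g := fun y => -2 * ((y ^ 2)⁻¹ * (y ^ 2)⁻¹))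
      (fun y hy => ?_) (SymN.cmul isOpen_Ioi hp ?_ _)
    · have := hp y hy
      refine ((hasDerivAt_pow 2 y).inv (by positivity)).congr_deriv ?_
      push_cast
      field_simp
    · exact ih.mul isOpen_Ioi hp ih

theorem bd_inf {f : ℝ → ℝ} (K : ℝ) (hK : 0 ≤ K)
    (h : ∀ y, 1 < y → |f y| ≤ K * (y ^ 2)⁻¹) :
    ∃ C : ℝ, ∀ y ∈ Ioi (1:ℝ), |f y| ≤ C * (1 + y) ^ (-2 : ℤ) := by
  obtain ⟨C, hC⟩ := (invsq 0).bd
  refine ⟨K * C, fun y hy => (h y hy).trans ?_⟩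
  rw [mul_assoc]
  exact mul_le_mul_of_nonneg_left ((le_abs_self _).trans (hC y hy)) hK

/-- The derivative of `Lam1` for `y > 0`. -/
def phi1 (d : ℕ) (p : ℝ) (Q : ℝ → ℝ) : ℝ → ℝ :=
  fun y => (2 / (p - 1) + 2 - d) * deriv Q y - y * Q y ^ p

section GS
variable {d : ℕ} {p : ℝ} {Q : ℝ → ℝ}

theorem IsGroundState.d1 (hQ : IsGroundState d p Q) (y : ℝ) : HasDerivAt Q (deriv Q y) y :=
  (hQ.smooth.differentiable (by simp) y).hasDerivAt

theorem IsGroundState.smooth1 (hQ : IsGroundState d p Q) :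
    ContDiff ℝ (⊤ : ℕ∞) (deriv Q) := by
  have := hQ.smooth
  exact (contDiff_infty_iff_deriv.1 this).2

theorem IsGroundState.d2 (hQ : IsGroundState d p Q) (y : ℝ) (hy : 0 < y) :
    HasDerivAt (deriv Q) (-(((d : ℝ) - 1) / y * deriv Q y) - Q y ^ p) y := by
  have h := (hQ.smooth1.differentiable (by simp) y).hasDerivAt
  refine h.congr_deriv ?_
  linarith [hQ.ode y hy]

theorem IsGroundState.dlam (hQ : IsGroundState d p Q) (y : ℝ) (hy : 0 < y) :
    HasDerivAt (Lam1 p Q) (phi1 d p Q y) y := by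
  refine (((hQ.d1 y).const_mul (2 / (p - 1))).add
    ((hasDerivAt_id y).mul (hQ.d2 y hy))).congr_deriv ?_
  simp only [phi1, id]
  field_simp
  ring

theorem IsGroundState.dphi (hQ : IsGroundState d p Q) (hp1 : 1 < p) (y : ℝ) (hy : 0 < y) :
    HasDerivAt (phi1 d p Q)
      (-(((d : ℝ) - 1) / y * phi1 d p Q y) - p * Q y ^ (p - 1) * Lam1 p Q y) y := by
  have h0 := hQ.pos y hy.le
  have h1 := (hQ.d1 y).rpow_const (p := p) (Or.inl h0.ne')
  refine (((hQ.d2 y hy).const_mul (2 / (p - 1) + 2 - (d:ℝ))).sub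
    ((hasDerivAt_id y).mul h1)).congr_deriv ?_
  simp only [phi1, id, Lam1]
  have e : Q y ^ p = Q y ^ (p - 1) * Q y := by
    rw [← Real.rpow_add_one h0.ne']
    congr 1
    ring
  have hp' : p - 1 ≠ 0 := by linarith
  rw [e]
  field_simp
  ring

theorem IsGroundState.cont_rpow (hQ : IsGroundState d p Q) (s : ℝ) :
    ContinuousOn (fun y => Q y ^ s) (Ici 0) :=
  hQ.smooth.continuous.continuousOn.rpow_const (fun y hy => Or.inl (hQ.pos y hy).ne')

theorem IsGroundState.q1_nonpos (hQ : IsGroundState d p Q) (hd : 11 ≤ d) (y : ℝ) (hy : 0 < y) :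
    deriv Q y ≤ 0 := by
  have h := antiF (F := fun y => y ^ (d - 1) * deriv Q y) (F' := fun y => -(y ^ (d-1) * Q y ^ p))
    (by have := hQ.smooth1.continuous
        fun_prop)
    (fun y hy => by
      refine ((hasDerivAt_pow (d-1) y).mul (hQ.d2 y hy)).congr_deriv ?_
      obtain ⟨e, rfl⟩ : ∃ e, d = e + 2 := ⟨d - 2, by omega⟩
      simp only [show e + 2 - 1 = e + 1 by omega, Nat.add_sub_cancel]
      push_cast
      field_simp
      ring)
    (fun y hy => by
      have := Real.rpow_pos_of_pos (hQ.pos y hy.le) p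
      have : 0 < y ^ (d-1) * Q y ^ p := by positivity
      linarith)
  have h1 := h (show (0:ℝ) ∈ Ici 0 by simp) (show y ∈ Ici 0 from hy.le) hy.le
  simp only [hQ.deriv0, mul_zero] at h1
  have : 0 < y ^ (d-1) := by positivity
  by_contra hcon
  push Not at hcon
  have := mul_pos this hcon
  linarith

theorem IsGroundState.q1_lower (hQ : IsGroundState d p Q) (hd : 11 ≤ d) (hp1 : 1 < p)
    (y : ℝ) (hy : 0 < y) : y * Q y ^ p ≤ d * (-deriv Q y) := by
  have h := antiF (F := fun y => y ^ (d - 1) * deriv Q y + y ^ d / d * Q y ^ p)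
    (F' := fun y => y ^ d / d * (deriv Q y * p * Q y ^ (p - 1)))
    (by have := hQ.smooth1.continuous
        have := hQ.cont_rpow p
        fun_prop)
    (fun y hy => by
      have h1 := (hQ.d1 y).rpow_const (p := p) (Or.inl (hQ.pos y hy.le).ne')
      refine (((hasDerivAt_pow (d-1) y).mul (hQ.d2 y hy)).add
        (((hasDerivAt_pow d y).div_const d).mul h1)).congr_deriv ?_
      obtain ⟨e, rfl⟩ : ∃ e, d = e + 2 := ⟨d - 2, by omega⟩
      simp only [show e + 2 - 1 = e + 1 by omega, Nat.add_sub_cancel]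
      have : ((e + 2 : ℕ) : ℝ) ≠ 0 := by positivity
      field_simp
      push_cast
      ring)
    (fun y hy => by
      have h1 := Real.rpow_pos_of_pos (hQ.pos y hy.le) (p-1)
      have h2 := hQ.q1_nonpos hd y hy
      have h3 : 0 ≤ -deriv Q y * p * Q y ^ (p - 1) := by
        have : 0 ≤ -deriv Q y := by linarith
        positivity
      have : 0 ≤ y ^ d / d * (-deriv Q y * p * Q y ^ (p - 1)) := by positivity
      nlinarith)
  have h1 := h (show (0:ℝ) ∈ Ici 0 by simp) (show y ∈ Ici 0 from hy.le) hy.le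
  simp only [hQ.deriv0, mul_zero, zero_pow (show d ≠ 0 by omega), zero_div, zero_mul,
    add_zero] at h1
  have hy1 : 0 < y ^ (d-1) := by positivity
  have e : y ^ d = y ^ (d-1) * y := by
    rw [← pow_succ]; congr 1; omega
  have hd' : (0:ℝ) < d := by
    have : 0 < d := by omega
    exact_mod_cast this
  rw [e] at h1
  have h2 : y ^ (d-1) * (d * deriv Q y + y * Q y ^ p) ≤ 0 := by
    have : y ^ (d-1) * (d * deriv Q y + y * Q y ^ p)
      = d * (y ^ (d - 1) * deriv Q y + y ^ (d - 1) * y / d * Q y ^ p) := by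
      field_simp
    rw [this]
    exact mul_nonpos_of_nonneg_of_nonpos hd'.le h1
  by_contra hcon
  push Not at hcon
  have := mul_pos hy1 (show 0 < d * deriv Q y + y * Q y ^ p by linarith)
  linarith

theorem IsGroundState.anti_phi (hQ : IsGroundState d p Q) (hd : 11 ≤ d) (hp1 : 1 < p)
    (hpos : ∀ y : ℝ, 0 ≤ y → 0 < Lam1 p Q y) :
    AntitoneOn (fun y => y ^ (d - 1) * phi1 d p Q y) (Ici 0) := by
  refine antiF (F' := fun y => -(y ^ (d-1) * (p * Q y ^ (p - 1) * Lam1 p Q y))) ?_ ?_ ?_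
  · have := hQ.smooth1.continuous
    have := hQ.cont_rpow p
    unfold phi1
    fun_prop
  · intro y hy
    refine ((hasDerivAt_pow (d-1) y).mul (hQ.dphi hp1 y hy)).congr_deriv ?_
    obtain ⟨e, rfl⟩ : ∃ e, d = e + 2 := ⟨d - 2, by omega⟩
    simp only [show e + 2 - 1 = e + 1 by omega, Nat.add_sub_cancel]
    push_cast
    field_simp
    ring
  · intro y hy
    have := Real.rpow_pos_of_pos (hQ.pos y hy.le) (p-1)
    have := hpos y hy.le
    have : 0 < y ^ (d-1) * (p * Q y ^ (p - 1) * Lam1 p Q y) := by positivity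
    linarith

theorem IsGroundState.phi_bd (hQ : IsGroundState d p Q) (hd : 11 ≤ d) (hp1 : 1 < p)
    (hpos : ∀ y : ℝ, 0 ≤ y → 0 < Lam1 p Q y) (y : ℝ) (hy : 0 < y) :
    y * |phi1 d p Q y| ≤ 2 ^ (d - 1) * Lam1 p Q y := by
  have ha := hQ.anti_phi hd hp1 hpos
  have hnp : ∀ z, 0 < z → phi1 d p Q z ≤ 0 := by
    intro z hz
    have h1 := ha (show (0:ℝ) ∈ Ici 0 by simp) (show z ∈ Ici 0 from hz.le) hz.le
    simp only [zero_pow (show d - 1 ≠ 0 by omega), zero_mul] at h1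
    by_contra hcon
    push Not at hcon
    have := mul_pos (show 0 < z ^ (d-1) by positivity) hcon
    linarith
  rw [abs_of_nonpos (hnp y hy)]
  obtain ⟨z, hz, hzd⟩ := exists_hasDerivAt_eq_slope (Lam1 p Q) (phi1 d p Q)
    (show y < 2 * y by linarith)
    (fun z hz => (hQ.dlam z (lt_of_lt_of_le hy hz.1)).continuousAt.continuousWithinAt)
    (fun z hz => hQ.dlam z (hy.trans hz.1))
  have hz0 : 0 < z := hy.trans hz.1
  have h1 := ha (show y ∈ Ici 0 from hy.le) (show z ∈ Ici 0 from hz0.le) hz.1.le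
  simp only at h1
  have h2 : z ^ (d-1) ≤ 2 ^ (d-1) * y ^ (d-1) := by
    rw [← mul_pow]
    exact pow_le_pow_left₀ hz0.le hz.2.le _
  have h3 : 2 ^ (d-1) * phi1 d p Q z ≤ phi1 d p Q y := by
    have hyp : 0 < y ^ (d-1) := by positivity
    have : y ^ (d-1) * (2 ^ (d-1) * phi1 d p Q z) ≤ y ^ (d-1) * phi1 d p Q y := by
      have := mul_le_mul_of_nonpos_right h2 (hnp z hz0)
      nlinarith
    exact le_of_mul_le_mul_left this hyp
  have h4 : y * phi1 d p Q z = Lam1 p Q (2 * y) - Lam1 p Q y := by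
    rw [hzd]
    field_simp
    ring
  have h5 := hpos (2 * y) (by positivity)
  have h6 := hpos y hy.le
  have h7 : (0:ℝ) < 2 ^ (d-1) := by positivity
  have h8 : y * (2 ^ (d-1) * phi1 d p Q z) ≤ y * phi1 d p Q y :=
    mul_le_mul_of_nonneg_left h3 hy.le
  have h9 : y * (2 ^ (d-1) * phi1 d p Q z) = 2 ^ (d-1) * (Lam1 p Q (2 * y) - Lam1 p Q y) := by
    rw [← h4]; ring
  nlinarith [mul_pos h7 h5]

/-- `w = W / y`. -/
def wfun (d : ℕ) (p : ℝ) (Q : ℝ → ℝ) : ℝ → ℝ := fun y => phi1 d p Q y / (y * Lam1 p Q y)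

theorem IsGroundState.w_inf (hQ : IsGroundState d p Q) (hd : 11 ≤ d) (hp1 : 1 < p)
    (hpos : ∀ y : ℝ, 0 ≤ y → 0 < Lam1 p Q y) (n : ℕ) :
    SymN (Ioi 1) n (-2) (fun y => Q y ^ (p - 1)) ∧
    SymN (Ioi 1) n (-2) (fun y => deriv Q y / (y * Q y)) ∧
    SymN (Ioi 1) n (-2) (wfun d p Q) := by
  have hI : IsOpen (Ioi (1:ℝ)) := isOpen_Ioi
  have hp : ∀ y ∈ Ioi (1:ℝ), 0 < y := fun y hy => zero_lt_one.trans hy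
  have hpp : 0 < p - 1 := by linarith
  have hd0 : (0:ℝ) < d := by
    have : 0 < d := by omega
    exact_mod_cast this
  have hr : ∀ y, 0 < y → y * (-deriv Q y) ≤ 2 / (p-1) * Q y := by
    intro y hy
    have := hpos y hy.le
    simp only [Lam1] at this
    linarith
  have b1 : ∃ C : ℝ, ∀ y ∈ Ioi (1:ℝ), |Q y ^ (p-1)| ≤ C * (1 + y) ^ (-2 : ℤ) := by
    refine bd_inf (d * (2 / (p-1))) (by positivity) (fun y hy => ?_)
    have h0 : 0 < y := hp y hy
    have hq := hQ.pos y h0.le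
    have hv := Real.rpow_pos_of_pos hq (p-1)
    rw [abs_of_pos hv, ← div_eq_mul_inv, le_div_iff₀ (by positivity)]
    have h1 := hQ.q1_lower hd hp1 y h0
    have h2 := hr y h0
    have e : Q y ^ p = Q y ^ (p - 1) * Q y := by
      rw [← Real.rpow_add_one hq.ne']
      congr 1
      ring
    rw [e] at h1
    have h3 : (Q y ^ (p-1) * y ^ 2) * Q y ≤ (d * (2 / (p-1))) * Q y := by
      have := mul_le_mul_of_nonneg_left h1 h0.le
      have := mul_le_mul_of_nonneg_left h2 hd0.le
      nlinarith
    exact le_of_mul_le_mul_right h3 hq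
  have b2 : ∃ C : ℝ, ∀ y ∈ Ioi (1:ℝ), |deriv Q y / (y * Q y)| ≤ C * (1 + y) ^ (-2 : ℤ) := by
    refine bd_inf (2 / (p-1)) (by positivity) (fun y hy => ?_)
    have h0 : 0 < y := hp y hy
    have hq := hQ.pos y h0.le
    have h2 := hr y h0
    rw [abs_div, abs_of_nonpos (hQ.q1_nonpos hd y h0), abs_of_pos (by positivity),
      ← div_eq_mul_inv, div_le_div_iff₀ (by positivity) (by positivity)]
    have := mul_le_mul_of_nonneg_left h2 h0.le
    nlinarith
  have b3 : ∃ C : ℝ, ∀ y ∈ Ioi (1:ℝ), |wfun d p Q y| ≤ C * (1 + y) ^ (-2 : ℤ) := by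
    refine bd_inf (2 ^ (d-1)) (by positivity) (fun y hy => ?_)
    have h0 : 0 < y := hp y hy
    have hq := hpos y h0.le
    have h2 := hQ.phi_bd hd hp1 hpos y h0
    rw [wfun, abs_div, abs_of_pos (show 0 < y * Lam1 p Q y by positivity),
      ← div_eq_mul_inv, div_le_div_iff₀ (by positivity) (by positivity)]
    have := mul_le_mul_of_nonneg_left h2 h0.le
    nlinarith
  induction n with
  | zero => exact ⟨b1, b2, b3⟩
  | succ n ih =>
    obtain ⟨i1, i2, i3⟩ := ih
    have hs := invsq n
    refine ⟨?_, ?_, ?_⟩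
    · refine SymN.intro hI hp b1
        (g := fun y => (p-1) * (Q y ^ (p-1) * (deriv Q y / (y * Q y)))) (fun y hy => ?_)
        ((i1.mul hI hp i2).cmul hI hp _)
      have h0 : 0 < y := hp y hy
      have hq := hQ.pos y h0.le
      refine ((hQ.d1 y).rpow_const (p := p-1) (Or.inl hq.ne')).congr_deriv ?_
      rw [Real.rpow_sub_one hq.ne' (p-1)]
      field_simp
    · refine SymN.intro hI hp b2
        (g := fun y => (-d : ℝ) * (deriv Q y / (y * Q y) * (y ^ 2)⁻¹) +
          ((-1) * (deriv Q y / (y * Q y) * (deriv Q y / (y * Q y))) +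
          (-1) * (Q y ^ (p-1) * (y^2)⁻¹))) (fun y hy => ?_)
        (((i2.mul hI hp hs).cmul hI hp _).add hI hp
          (((i2.mul hI hp i2).cmul hI hp _).add hI hp ((i1.mul hI hp hs).cmul hI hp _)))
      have h0 : 0 < y := hp y hy
      have hq := hQ.pos y h0.le
      refine ((hQ.d2 y h0).div ((hasDerivAt_id y).mul (hQ.d1 y)) (by simp only [Pi.mul_apply, id]; positivity)).congr_deriv ?_
      have e : Q y ^ p = Q y ^ (p - 1) * Q y := by
        rw [← Real.rpow_add_one hq.ne']
        congr 1
        ring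
      simp only [id, e, Pi.mul_apply]
      field_simp
      ring
    · refine SymN.intro hI hp b3
        (g := fun y => (-d : ℝ) * (wfun d p Q y * (y ^ 2)⁻¹) +
          ((-1) * (wfun d p Q y * wfun d p Q y) +
          (-p) * (Q y ^ (p-1) * (y^2)⁻¹))) (fun y hy => ?_)
        (((i3.mul hI hp hs).cmul hI hp _).add hI hp
          (((i3.mul hI hp i3).cmul hI hp _).add hI hp ((i1.mul hI hp hs).cmul hI hp _)))
      have h0 : 0 < y := hp y hy
      have hq := hpos y h0.le
      refine ((hQ.dphi hp1 y h0).div ((hasDerivAt_id y).mul (hQ.dlam y h0)) (by simp only [Pi.mul_apply, id]; positivity)).congr_deriv ?_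
      simp only [id, wfun, Pi.mul_apply]
      field_simp
      ring

theorem IsGroundState.w_zero (hQ : IsGroundState d p Q) (hd : 11 ≤ d)
    (hpos : ∀ y : ℝ, 0 ≤ y → 0 < Lam1 p Q y) (n : ℕ) :
    SymN (Ioo 0 2) n (-2) (wfun d p Q) := by
  have hI : IsOpen (Ioo (0:ℝ) 2) := isOpen_Ioo
  have hp : ∀ y ∈ Ioo (0:ℝ) 2, 0 < y := fun y hy => hy.1
  have hself : ∀ y ∈ Ioo (0:ℝ) 2, 0 < y ∧ y < 2 := fun y hy => hy
  have low : ∀ f : ℝ → ℝ, Continuous f → (∀ y, 0 ≤ y → 0 < f y) →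
      ∃ ε, 0 < ε ∧ ∀ y ∈ Ioo (0:ℝ) 2, ε ≤ f y := by
    intro f hf h0
    obtain ⟨z, hz, hm⟩ := (isCompact_Icc (a := (0:ℝ)) (b := 2)).exists_isMinOn
      (nonempty_Icc.2 (by norm_num)) hf.continuousOn
    exact ⟨f z, h0 z hz.1, fun y hy => hm ⟨hy.1.le, hy.2.le⟩⟩
  have lamc : Continuous (Lam1 p Q) := by
    have := hQ.smooth.continuous
    have := hQ.smooth1.continuous
    unfold Lam1
    fun_prop
  obtain ⟨ε, hε, hQe⟩ := low Q hQ.smooth.continuous hQ.pos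
  obtain ⟨η, hη, hLe⟩ := low (Lam1 p Q) lamc hpos
  have step : ∀ n, SymN (Ioo 0 2) n 0 Q → SymN (Ioo 0 2) n 0 (fun y => deriv Q y / y) := by
    intro n h
    refine lemZ (c := d) (by omega) (fun y hy => ?_) (h.rpow hI hp hε hQe p) ?_
    · have h0 := hp y hy
      refine ((hQ.d2 y h0).div (hasDerivAt_id y) h0.ne').congr_deriv ?_
      simp only [id]
      field_simp
      ring
    · have : Tendsto (fun y : ℝ => y ^ (d-1) * deriv Q y) (𝓝 0) (𝓝 (0 ^ (d-1) * deriv Q 0)) :=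
        ((continuous_pow (d-1)).mul hQ.smooth1.continuous).tendsto 0
      rw [hQ.deriv0, mul_zero] at this
      refine (this.mono_left nhdsWithin_le_nhds).congr' ?_
      filter_upwards [self_mem_nhdsWithin] with y hy
      have : 0 < y := hy
      have e : y ^ d = y ^ (d-1) * y := by
        rw [← pow_succ]; congr 1; omega
      rw [e]
      field_simp
  have hS : ∀ n, SymN (Ioo 0 2) n 0 Q := by
    intro n
    have hb : ∃ C : ℝ, ∀ y ∈ Ioo (0:ℝ) 2, |Q y| ≤ C * (1 + y) ^ (0:ℤ) := by
      obtain ⟨C, hC⟩ := (isCompact_Icc (a := (0:ℝ)) (b := 2)).exists_bound_of_continuousOn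
        hQ.smooth.continuous.continuousOn
      exact ⟨C, fun y hy => by simpa using hC y ⟨hy.1.le, hy.2.le⟩⟩
    induction n with
    | zero => exact hb
    | succ n ih =>
      exact ⟨hb, fun y hy => (hQ.d1 y).differentiableAt, (step n ih).chg hself _⟩
  have hL : ∀ n, SymN (Ioo 0 2) n 0 (Lam1 p Q) := by
    intro n
    have h1 := (hS n).cmul hI hp (2 / (p-1))
    have h2 := ((SymN.sq hI hp n).mul hI hp (step n (hS n))).chg hself 0
    refine (h1.add hI hp h2).congr hI (fun y hy => ?_)
    have := hp y hy
    simp only [Lam1]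
    field_simp
  have h1 := (((hL (n+1)).2.2).mul hI hp ((hL n).rpow hI hp hη hLe (-1))).chg hself (-2)
  refine h1.congr hI (fun y hy => ?_)
  have := hp y hy
  have hl := hpos y this.le
  simp only [(hQ.dlam y this).deriv, wfun, Real.rpow_neg_one]
  field_simp

theorem IsGroundState.w_sym (hQ : IsGroundState d p Q) (hd : 11 ≤ d) (hp1 : 1 < p)
    (hpos : ∀ y : ℝ, 0 ≤ y → 0 < Lam1 p Q y) (n : ℕ) :
    SymN (Ioi 0) n (-2) (wfun d p Q) :=
  (hQ.w_zero hd hpos n).glue (hQ.w_inf hd hp1 hpos n).2.2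

theorem IsGroundState.W_eq (hQ : IsGroundState d p Q)
    (hpos : ∀ y : ℝ, 0 ≤ y → 0 < Lam1 p Q y) (y : ℝ) (hy : 0 < y) :
    Wpot p Q y = y * wfun d p Q y := by
  have hl := hpos y hy.le
  rw [Wpot, ((hQ.dlam y hy).log hl.ne').deriv, wfun]
  field_simp

theorem IsGroundState.W_smooth (hQ : IsGroundState d p Q)
    (hpos : ∀ y : ℝ, 0 ≤ y → 0 < Lam1 p Q y) :
    ContDiffOn ℝ (⊤ : ℕ∞) (Wpot p Q) (Ioi 0) := by
  have h1 : ContDiff ℝ (⊤ : ℕ∞) (Lam1 p Q) := by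
    have := hQ.smooth
    have := hQ.smooth1
    unfold Lam1
    fun_prop
  have h2 : ContDiffOn ℝ (⊤ : ℕ∞) (fun z => Real.log (Lam1 p Q z)) (Ioi 0) :=
    h1.contDiffOn.log (fun y hy => (hpos y (le_of_lt hy)).ne')
  exact h2.deriv_of_isOpen isOpen_Ioi (by simp)

end GS

/-- Symbols of all orders on the half line. -/
def Sym (m : ℤ) (f : ℝ → ℝ) : Prop := ∀ n, SymN (Ioi 0) n m f

theorem posI : ∀ y ∈ Ioi (0:ℝ), 0 < y := fun _ hy => hy

theorem Sym.add {m : ℤ} {f g : ℝ → ℝ} (hf : Sym m f) (hg : Sym m g) :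
    Sym m (fun y => f y + g y) := fun n => (hf n).add isOpen_Ioi posI (hg n)

theorem Sym.mul {m m' : ℤ} {f g : ℝ → ℝ} (hf : Sym m f) (hg : Sym m' g) :
    Sym (m + m') (fun y => f y * g y) := fun n => (hf n).mul isOpen_Ioi posI (hg n)

theorem Sym.cmul {m : ℤ} {f : ℝ → ℝ} (hf : Sym m f) (c : ℝ) :
    Sym m (fun y => c * f y) := fun n => (hf n).cmul isOpen_Ioi posI c

theorem Sym.zero (m : ℤ) : Sym m (fun _ => 0) := fun n => SymN.zero isOpen_Ioi posI n m

theorem Sym.der {m : ℤ} {f : ℝ → ℝ} (hf : Sym m f) :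
    Sym (m - 2) (fun y => deriv f y / y) ∧
      ∀ y, 0 < y → HasDerivAt f (y * (deriv f y / y)) y :=
  ⟨fun n => (hf (n+1)).2.2, fun y hy => (hf 1).der posI y hy⟩

/-- Coefficient class: order `m` decay, with parity of `m` at the origin. -/
def Cf (m : ℕ) (a : ℝ → ℝ) : Prop :=
  ∃ g, Sym (-((m + m % 2 : ℕ) : ℤ)) g ∧ ∀ y, 0 < y → a y = y ^ (m % 2) * g y

theorem Cf.add {m : ℕ} {a b : ℝ → ℝ} (ha : Cf m a) (hb : Cf m b) :
    Cf m (fun y => a y + b y) := by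
  obtain ⟨g, hg, h1⟩ := ha
  obtain ⟨k, hk, h2⟩ := hb
  refine ⟨_, hg.add hk, fun y hy => ?_⟩
  simp only [h1 y hy, h2 y hy]
  ring

theorem Cf.cmul {m : ℕ} {a : ℝ → ℝ} (ha : Cf m a) (c : ℝ) :
    Cf m (fun y => c * a y) := by
  obtain ⟨g, hg, h1⟩ := ha
  refine ⟨_, hg.cmul c, fun y hy => ?_⟩
  simp only [h1 y hy]
  ring

theorem Cf.zero (m : ℕ) : Cf m (fun _ => 0) := ⟨_, Sym.zero _, fun y hy => by simp⟩

theorem Cf.bd {m : ℕ} {a : ℝ → ℝ} (ha : Cf m a) :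
    ∃ C : ℝ, 0 ≤ C ∧ ∀ y, 0 < y → |a y| ≤ C * ((1 + y) ^ m)⁻¹ := by
  obtain ⟨g, hg, h1⟩ := ha
  obtain ⟨C, hC⟩ := (hg 0).bd
  refine ⟨|C|, abs_nonneg _, fun y hy => ?_⟩
  have h2 := hC y hy
  rw [zpow_neg, zpow_natCast, pow_add, mul_inv] at h2
  rw [h1 y hy, abs_mul, abs_of_pos (show 0 < y ^ (m % 2) by positivity)]
  have h3 : y ^ (m % 2) ≤ (1 + y) ^ (m % 2) := by gcongr; linarith
  have h4 : 0 < (1 + y) ^ (m % 2) := by positivity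
  have h5 : 0 < ((1 + y) ^ m)⁻¹ := by positivity
  calc y ^ (m % 2) * |g y| ≤ (1 + y) ^ (m % 2) * |g y| := by gcongr
    _ ≤ (1 + y) ^ (m % 2) * (C * (((1 + y) ^ m)⁻¹ * ((1 + y) ^ (m % 2))⁻¹)) := by gcongr
    _ = C * ((1 + y) ^ m)⁻¹ := by field_simp
    _ ≤ _ := by
      gcongr
      exact le_abs_self C

theorem Cf.of_even {m : ℕ} {g : ℝ → ℝ} (h : m % 2 = 0) (hg : Sym (-(m : ℤ)) g) : Cf m g :=
  ⟨g, by rw [h]; simpa using hg, fun y hy => by rw [h]; simp⟩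

theorem Cf.of_odd {m : ℕ} {g : ℝ → ℝ} (h : m % 2 = 1) (hg : Sym (-(m : ℤ) - 1) g) :
    Cf m (fun y => y * g y) :=
  ⟨g, by rw [h]; convert hg using 1; push_cast; ring, fun y hy => by rw [h]; simp⟩

theorem Cf.congr {m : ℕ} {a b : ℝ → ℝ} (ha : Cf m a) (h : ∀ y, 0 < y → a y = b y) : Cf m b := by
  obtain ⟨g, hg, h1⟩ := ha
  exact ⟨g, hg, fun y hy => by rw [← h y hy, h1 y hy]⟩

theorem Cf.parts {m : ℕ} {a : ℝ → ℝ} (ha : Cf m a) :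
    (m % 2 = 0 ∧ Sym (-(m : ℤ)) a) ∨
    (m % 2 = 1 ∧ ∃ g, Sym (-(m : ℤ) - 1) g ∧ ∀ y, 0 < y → a y = y * g y) := by
  obtain ⟨g, hg, h1⟩ := ha
  rcases Nat.mod_two_eq_zero_or_one m with h | h
  · left
    rw [h] at hg h1
    refine ⟨h, fun n => ((hg n).congr isOpen_Ioi (g := a) (fun y hy => ?_))⟩
    rw [h1 y hy]; simp
  · right
    rw [h] at hg h1
    refine ⟨h, g, ?_, fun y hy => by simpa using h1 y hy⟩
    convert hg using 1
    push_cast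
    ring

theorem Cf.der {m : ℕ} {a : ℝ → ℝ} (ha : Cf m a) :
    ∃ b, Cf (m + 1) b ∧ ∀ y, 0 < y → HasDerivAt a (b y) y := by
  rcases ha.parts with ⟨h, hs⟩ | ⟨h, g, hg, e⟩
  · obtain ⟨h1, h2⟩ := hs.der
    refine ⟨_, Cf.of_odd (by omega) ?_, h2⟩
    convert h1 using 1
    push_cast
    ring
  · obtain ⟨h1, h2⟩ := hg.der
    have hsq : Sym 2 (fun y => y ^ 2) := fun n => SymN.sq isOpen_Ioi posI n
    have h3 := hsq.mul h1
    rw [show (2:ℤ) + (-(m:ℤ) - 1 - 2) = -(m:ℤ) - 1 by ring] at h3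
    refine ⟨_, Cf.of_even (by omega) (g := fun y => g y + y ^ 2 * (deriv g y / y)) ?_, ?_⟩
    · convert hg.add h3 using 1
      push_cast
      ring
    · intro y hy
      have := ((hasDerivAt_id y).mul (h2 y hy)).congr_of_eventuallyEq (f₁ := a)
        (by filter_upwards [isOpen_Ioi.mem_nhds hy] with z hz using e z hz)
      refine this.congr_deriv ?_
      simp only [id]
      ring

theorem Cf.mulw {m : ℕ} {a w : ℝ → ℝ} (ha : Cf m a) (hw : Sym (-2) w) :
    Cf (m + 1) (fun y => y * w y * a y) := by
  rcases ha.parts with ⟨h, hs⟩ | ⟨h, g, hg, e⟩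
  · refine (Cf.of_odd (by omega) (g := fun y => w y * a y) ?_).congr (fun y hy => by ring)
    convert hw.mul hs using 1
    push_cast
    ring
  · have hsq : Sym 2 (fun y => y ^ 2) := fun n => SymN.sq isOpen_Ioi posI n
    refine (Cf.of_even (by omega) (g := fun y => y ^ 2 * (w y * g y)) ?_).congr
      (fun y hy => by rw [e y hy]; ring)
    convert hsq.mul (hw.mul hg) using 1
    push_cast
    ring

theorem Cf.divy {m : ℕ} {a : ℝ → ℝ} (h : m % 2 = 1) (ha : Cf m a) :
    Cf (m + 1) (fun y => a y / y) := by
  rcases ha.parts with ⟨h', hs⟩ | ⟨h, g, hg, e⟩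
  · omega
  · refine (Cf.of_even (by omega) (g := g) ?_).congr
      (fun y hy => by rw [e y hy]; field_simp)
    convert hg using 1
    push_cast
    ring

theorem stepB {m j : ℕ} {a w v : ℝ → ℝ} (ha : Cf m a) (hw : Sym (-2) w) (hv : Sym (-2) v)
    (D : ℝ) : ∃ a' B : ℝ → ℝ, Cf (m + 1) B ∧ ∀ y, 0 < y → HasDerivAt a (a' y) y ∧
      B y = a' y + a y * (y * w y - ((j % 2 : ℕ) : ℝ) * D / y)
        - (y * v y - (((j + m) % 2 : ℕ) : ℝ) * D / y) * a y := by
  obtain ⟨b, hb, hd⟩ := ha.der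
  have h1 := (hb.add (ha.mulw hw)).add ((ha.mulw hv).cmul (-1))
  rcases Nat.mod_two_eq_zero_or_one m with h | h
  · refine ⟨b, _, h1, fun y hy => ⟨hd y hy, ?_⟩⟩
    rw [show (j + m) % 2 = j % 2 by omega]
    ring
  · refine ⟨b, _, h1.add ((ha.divy h).cmul
      (((((j + m) % 2 : ℕ) : ℝ) - ((j % 2 : ℕ) : ℝ)) * D)), fun y hy => ⟨hd y hy, ?_⟩⟩
    ring

/-- A ladder system of functions on the half line. -/
def Sys (D : ℝ) (s : ℕ → ℝ) (w : ℕ → ℝ → ℝ) (X : ℕ → ℝ → ℝ) : Prop :=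
  ∀ j y, 0 < y → HasDerivAt (X j)
    (s j * X (j+1) y + (y * w j y - ((j % 2 : ℕ) : ℝ) * D / y) * X j y) y

theorem triang (D : ℝ) (s t : ℕ → ℝ) (w v : ℕ → ℝ → ℝ) (hw : ∀ j, Sym (-2) (w j))
    (hv : ∀ j, Sym (-2) (v j)) (ht : ∀ j, t j * t j = 1) (i : ℕ) :
    ∃ a : ℕ → ℝ → ℝ, (∀ j, j ≤ i → Cf (i - j) (a j)) ∧
      ∀ X Y, Sys D s w X → Sys D t v Y → (∀ y, 0 < y → Y 0 y = X 0 y) →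
        ∀ y, 0 < y → Y i y = ∑ j ∈ Finset.range (i + 1), a j y * X j y := by
  induction i with
  | zero =>
    refine ⟨fun _ _ => 1, fun j hj => ?_, fun X Y _ _ h y hy => by simp [h y hy]⟩
    refine Cf.of_even (by simp) (fun n => ?_)
    simpa using SymN.const isOpen_Ioi posI n 1
  | succ i ih =>
    obtain ⟨a, ha, hrep⟩ := ih
    have hB : ∀ j, ∃ a' B : ℝ → ℝ, j ≤ i → Cf (i - j + 1) B ∧ ∀ y, 0 < y →
        HasDerivAt (a j) (a' y) y ∧
        B y = a' y + a j y * (y * w j y - ((j % 2 : ℕ) : ℝ) * D / y)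
          - (y * v i y - ((i % 2 : ℕ) : ℝ) * D / y) * a j y := by
      intro j
      by_cases hj : j ≤ i
      · obtain ⟨a', B, h⟩ := stepB (j := j) (ha j hj) (hw j) (hv i) D
        rw [show j + (i - j) = i by omega] at h
        exact ⟨a', B, fun _ => h⟩
      · exact ⟨0, 0, fun h => absurd h hj⟩
    choose a' B hB using hB
    refine ⟨fun j y => t i * ((if j ≤ i then B j y else 0) +
      (if j = 0 then 0 else s (j - 1) * a (j - 1) y)), fun j hj => ?_, ?_⟩
    · refine Cf.cmul (Cf.add ?_ ?_) _
      · by_cases h : j ≤ i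
        · simp only [h, if_true]
          rw [show i + 1 - j = i - j + 1 by omega]
          exact (hB j h).1
        · simp only [h, if_false]
          exact Cf.zero _
      · by_cases h : j = 0
        · simp only [h, if_true]
          exact Cf.zero _
        · simp only [h, if_false]
          have := (ha (j-1) (by omega)).cmul (s (j-1))
          rwa [show i - (j - 1) = i + 1 - j by omega] at this
    · intro X Y hX hY h0 y hy
      have hr := hrep X Y hX hY h0
      have d1 := hY i y hy
      have d2 : HasDerivAt (fun z => ∑ j ∈ Finset.range (i + 1), a j z * X j z)
          (∑ j ∈ Finset.range (i + 1), (a' j y * X j y + a j y *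
            (s j * X (j+1) y + (y * w j y - ((j % 2 : ℕ) : ℝ) * D / y) * X j y))) y := by
        refine HasDerivAt.fun_sum (fun j hj => ?_)
        have hj' : j ≤ i := by
          have := Finset.mem_range.1 hj
          omega
        exact (((hB j hj').2 y hy).1).mul (hX j y hy)
      have d3 := d2.congr_of_eventuallyEq (f₁ := Y i)
        (by filter_upwards [isOpen_Ioi.mem_nhds hy] with z hz using hr z hz)
      have e := d1.unique d3
      have e2 : Y (i+1) y = t i * (∑ j ∈ Finset.range (i + 1), (a' j y * X j y + a j y *
            (s j * X (j+1) y + (y * w j y - ((j % 2 : ℕ) : ℝ) * D / y) * X j y))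
            - (y * v i y - ((i % 2 : ℕ) : ℝ) * D / y) * Y i y) := by
        rw [← e]
        have := ht i
        linear_combination (-Y (i+1) y) * this
      rw [e2, hr y hy, Finset.mul_sum, ← Finset.sum_sub_distrib]
      simp only [mul_assoc]
      rw [← Finset.mul_sum]
      congr 1
      simp only [add_mul, Finset.sum_add_distrib]
      rw [Finset.sum_range_succ (n := i+1) (f := fun j => (if j ≤ i then B j y else 0) * X j y),
        Finset.sum_range_succ' (n := i+1)]
      simp only [show ¬ (i + 1 ≤ i) by omega, if_false, if_true, zero_mul, add_zero,
        Nat.add_sub_cancel, Nat.add_eq_zero_iff, one_ne_zero, and_false]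
      rw [← Finset.sum_add_distrib]
      refine Finset.sum_congr rfl (fun j hj => ?_)
      have hj' : j ≤ i := by
        have := Finset.mem_range.1 hj
        omega
      simp only [hj', if_true]
      rw [((hB j hj').2 y hy).2]
      ring

theorem wt_le (y : ℝ) (hy : 0 < y) {i j k : ℕ} (hji : j ≤ i) (hik : i ≤ k) :
    (((1 + y) ^ (i - j))⁻¹) ^ 2 / (1 + y ^ (2 * (k - i))) ≤ 1 / (1 + y ^ (2 * (k - j))) := by
  rw [inv_pow, ← pow_mul, mul_comm (i - j) 2, inv_eq_one_div, div_div]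
  apply one_div_le_one_div_of_le (by positivity)
  rw [show 2 * (k - j) = 2 * (i - j) + 2 * (k - i) by omega, pow_add]
  have h1 : 1 ≤ (1 + y) ^ (2 * (i - j)) := one_le_pow₀ (by linarith)
  have h2 : y ^ (2 * (i - j)) ≤ (1 + y) ^ (2 * (i - j)) := by gcongr; linarith
  have h3 : 0 < y ^ (2 * (k - i)) := by positivity
  nlinarith [mul_le_mul_of_nonneg_right h2 h3.le]

theorem ptwise (D : ℝ) (s t : ℕ → ℝ) (w v : ℕ → ℝ → ℝ) (hw : ∀ j, Sym (-2) (w j))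
    (hv : ∀ j, Sym (-2) (v j)) (ht : ∀ j, t j * t j = 1) (k i : ℕ) (hik : i ≤ k) :
    ∃ C : ℝ, 0 ≤ C ∧
      ∀ X Y, Sys D s w X → Sys D t v Y → (∀ y, 0 < y → Y 0 y = X 0 y) →
        ∀ y, 0 < y → (Y i y) ^ 2 / (1 + y ^ (2 * (k - i))) ≤
          C * ∑ j ∈ Finset.range (k + 1), (X j y) ^ 2 / (1 + y ^ (2 * (k - j))) := by
  obtain ⟨a, ha, hrep⟩ := triang D s t w v hw hv ht i
  have hb : ∀ j, ∃ C : ℝ, 0 ≤ C ∧ (j ≤ i → ∀ y, 0 < y → |a j y| ≤ C * ((1 + y) ^ (i - j))⁻¹) := by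
    intro j
    by_cases h : j ≤ i
    · obtain ⟨C, h0, hC⟩ := (ha j h).bd
      exact ⟨C, h0, fun _ => hC⟩
    · exact ⟨0, le_rfl, fun h' => absurd h' h⟩
  choose C hC0 hC using hb
  refine ⟨(i + 1) * ∑ j ∈ Finset.range (i+1), C j ^ 2, by positivity, ?_⟩
  intro X Y hX hY h0 y hy
  rw [hrep X Y hX hY h0 y hy]
  have hden : 0 < 1 + y ^ (2 * (k - i)) := by positivity
  have h1 := sq_sum_le_card_mul_sum_sq (s := Finset.range (i+1)) (f := fun j => a j y * X j y)
  rw [Finset.card_range] at h1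
  push_cast at h1
  calc _ ≤ ((i:ℝ) + 1) * (∑ j ∈ Finset.range (i+1), (a j y * X j y) ^ 2)
          / (1 + y ^ (2 * (k - i))) := by gcongr
    _ = ((i:ℝ) + 1) * ∑ j ∈ Finset.range (i+1), (a j y * X j y) ^ 2
          / (1 + y ^ (2 * (k - i))) := by rw [mul_div_assoc, Finset.sum_div]
    _ ≤ ((i:ℝ) + 1) * ∑ j ∈ Finset.range (i+1), (∑ l ∈ Finset.range (i+1), C l ^ 2) *
          ((X j y) ^ 2 / (1 + y ^ (2 * (k - j)))) := by
        gcongr with j hj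
        have hj' : j ≤ i := by
          have := Finset.mem_range.1 hj
          omega
        have e1 : (a j y) ^ 2 ≤ (C j * ((1 + y) ^ (i - j))⁻¹) ^ 2 := by
          rw [← sq_abs (a j y)]
          exact pow_le_pow_left₀ (abs_nonneg _) (hC j hj' y hy) 2
        have e2 : C j ^ 2 ≤ ∑ l ∈ Finset.range (i+1), C l ^ 2 :=
          Finset.single_le_sum (f := fun l => C l ^ 2) (fun l _ => by positivity) hj
        have e3 := wt_le y hy hj' hik
        calc (a j y * X j y) ^ 2 / (1 + y ^ (2 * (k - i)))
            = (a j y) ^ 2 * (X j y) ^ 2 / (1 + y ^ (2 * (k - i))) := by rw [mul_pow]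
          _ ≤ (C j * ((1 + y) ^ (i - j))⁻¹) ^ 2 * (X j y) ^ 2 / (1 + y ^ (2 * (k - i))) := by
              gcongr
          _ = C j ^ 2 * (X j y) ^ 2 *
              ((((1 + y) ^ (i - j))⁻¹) ^ 2 / (1 + y ^ (2 * (k - i)))) := by ring
          _ ≤ C j ^ 2 * (X j y) ^ 2 * (1 / (1 + y ^ (2 * (k - j)))) := by gcongr
          _ = C j ^ 2 * ((X j y) ^ 2 / (1 + y ^ (2 * (k - j)))) := by ring
          _ ≤ _ := by gcongr
    _ = ((i:ℝ) + 1) * (∑ l ∈ Finset.range (i+1), C l ^ 2) *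
          ∑ j ∈ Finset.range (i+1), ((X j y) ^ 2 / (1 + y ^ (2 * (k - j)))) := by
        rw [← Finset.mul_sum, mul_assoc]
    _ ≤ _ := by
        gcongr

theorem oneside (d : ℕ) (D : ℝ) (s t : ℕ → ℝ) (w v : ℕ → ℝ → ℝ) (hw : ∀ j, Sym (-2) (w j))
    (hv : ∀ j, Sym (-2) (v j)) (ht : ∀ j, t j * t j = 1) (k : ℕ) :
    ∃ c : ℝ, 1 ≤ c ∧
      ∀ X Y : ℕ → ℝ → ℝ, Sys D s w X → Sys D t v Y → (∀ y, 0 < y → Y 0 y = X 0 y) →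
        (∑ i ∈ Finset.range (k + 1), ∫⁻ y in Ioi (0:ℝ),
          ENNReal.ofReal ((Y i y) ^ 2 / (1 + y ^ (2 * (k - i))) * y ^ (d - 1))) ≤
        ENNReal.ofReal c * ∑ i ∈ Finset.range (k + 1), ∫⁻ y in Ioi (0:ℝ),
          ENNReal.ofReal ((X i y) ^ 2 / (1 + y ^ (2 * (k - i))) * y ^ (d - 1)) := by
  have hp : ∀ i, ∃ C : ℝ, 0 ≤ C ∧ (i ≤ k →
      ∀ X Y, Sys D s w X → Sys D t v Y → (∀ y, 0 < y → Y 0 y = X 0 y) →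
        ∀ y, 0 < y → (Y i y) ^ 2 / (1 + y ^ (2 * (k - i))) ≤
          C * ∑ j ∈ Finset.range (k + 1), (X j y) ^ 2 / (1 + y ^ (2 * (k - j)))) := by
    intro i
    by_cases h : i ≤ k
    · obtain ⟨C, h0, hC⟩ := ptwise D s t w v hw hv ht k i h
      exact ⟨C, h0, fun _ => hC⟩
    · exact ⟨0, le_rfl, fun h' => absurd h' h⟩
  choose C hC0 hC using hp
  refine ⟨1 + ∑ i ∈ Finset.range (k+1), C i, ?_, ?_⟩
  · have : 0 ≤ ∑ i ∈ Finset.range (k+1), C i := Finset.sum_nonneg (fun i _ => hC0 i)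
    linarith
  intro X Y hX hY h0
  set S := ∑ i ∈ Finset.range (k + 1), ∫⁻ y in Ioi (0:ℝ),
          ENNReal.ofReal ((X i y) ^ 2 / (1 + y ^ (2 * (k - i))) * y ^ (d - 1)) with hS
  have hi : ∀ i ∈ Finset.range (k+1), ∫⁻ y in Ioi (0:ℝ),
          ENNReal.ofReal ((Y i y) ^ 2 / (1 + y ^ (2 * (k - i))) * y ^ (d - 1)) ≤
          ENNReal.ofReal (C i) * S := by
    intro i hi
    have hik : i ≤ k := by
      have := Finset.mem_range.1 hi
      omega
    have hmeas : ∀ j, AEMeasurable (fun y => ENNReal.ofReal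
        ((X j y) ^ 2 / (1 + y ^ (2 * (k - j))) * y ^ (d - 1))) (volume.restrict (Ioi (0:ℝ))) := by
      intro j
      refine AEMeasurable.ennreal_ofReal ?_
      refine ContinuousOn.aemeasurable ?_ measurableSet_Ioi
      have hc : ContinuousOn (X j) (Ioi 0) :=
        fun y hy => (hX j y hy).continuousAt.continuousWithinAt
      refine ContinuousOn.mul (ContinuousOn.div (hc.pow 2) (by fun_prop) ?_) (by fun_prop)
      intro y hy
      have : 0 < y := hy
      positivity
    rw [hS, ← lintegral_finsetSum' _ (fun j _ => hmeas j),
      ← lintegral_const_mul' _ _ ENNReal.ofReal_ne_top]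
    refine setLIntegral_mono_ae' measurableSet_Ioi (ae_of_all _ (fun y hy => ?_))
    have hy' : 0 < y := hy
    rw [← ENNReal.ofReal_sum_of_nonneg (fun j _ => by positivity),
      ← ENNReal.ofReal_mul (hC0 i)]
    apply ENNReal.ofReal_le_ofReal
    rw [← Finset.sum_mul, ← mul_assoc]
    exact mul_le_mul_of_nonneg_right (hC i hik X Y hX hY h0 y hy') (by positivity)
  calc _ ≤ ∑ i ∈ Finset.range (k+1), ENNReal.ofReal (C i) * S := Finset.sum_le_sum hi
    _ = ENNReal.ofReal (∑ i ∈ Finset.range (k+1), C i) * S := by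
        rw [← Finset.sum_mul, ENNReal.ofReal_sum_of_nonneg (fun i _ => hC0 i)]
    _ ≤ _ := by
        gcongr
        linarith

theorem Dop_smooth {d : ℕ} {u : ℝ → ℝ} (hu : ContDiff ℝ (⊤ : ℕ∞) u) (j : ℕ) :
    ContDiffOn ℝ (⊤ : ℕ∞) (Dop d j u) (Ioi 0) := by
  induction j with
  | zero => exact hu.contDiffOn
  | succ j ih =>
    have hd : ContDiffOn ℝ (⊤ : ℕ∞) (deriv (Dop d j u)) (Ioi 0) :=
      ih.deriv_of_isOpen isOpen_Ioi (by simp)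
    rw [Dop]
    split_ifs
    · exact hd
    · exact hd.add ((contDiffOn_const.div contDiffOn_id (fun y hy => (ne_of_gt hy))).mul ih)

theorem Dop_sys {d : ℕ} {u : ℝ → ℝ} (hu : ContDiff ℝ (⊤ : ℕ∞) u) :
    Sys ((d:ℝ) - 1) (fun _ => 1) (fun _ _ => 0) (fun j => Dop d j u) := by
  intro j y hy
  have h := (((Dop_smooth (d := d) hu j).differentiableOn (by simp)).differentiableAt
    (isOpen_Ioi.mem_nhds hy)).hasDerivAt
  refine h.congr_deriv ?_
  rcases Nat.mod_two_eq_zero_or_one j with h | h <;> simp [Dop, h]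

/-- Signs of the adapted ladder. -/
def adaps : ℕ → ℝ := fun j => if j % 2 = 0 then -1 else 1

/-- Potentials of the adapted ladder. -/
def adapw (d : ℕ) (p : ℝ) (Q : ℝ → ℝ) : ℕ → ℝ → ℝ :=
  fun j y => (if j % 2 = 0 then 1 else -1) * wfun d p Q y

theorem adaps_sq (j : ℕ) : adaps j * adaps j = 1 := by
  unfold adaps
  split_ifs <;> norm_num

theorem adapw_sym {d : ℕ} {p : ℝ} {Q : ℝ → ℝ} (hQ : IsGroundState d p Q) (hd : 11 ≤ d)
    (hp1 : 1 < p) (hpos : ∀ y : ℝ, 0 ≤ y → 0 < Lam1 p Q y) (j : ℕ) :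
    Sym (-2) (adapw d p Q j) := Sym.cmul (hQ.w_sym hd hp1 hpos) _

theorem Astar_eq {d : ℕ} {p : ℝ} {Q f : ℝ → ℝ} (hd : 11 ≤ d) (y : ℝ) (hy : 0 < y)
    (hf : DifferentiableAt ℝ f y) :
    Astar d p Q f y = deriv f y + ((d:ℝ) - 1) / y * f y + Wpot p Q y * f y := by
  have h := (hasDerivAt_pow (d-1) y).mul hf.hasDerivAt
  have h' : deriv (fun z => z ^ (d - 1) * f z) y = _ := h.deriv
  rw [Astar, h']
  obtain ⟨e, rfl⟩ : ∃ e, d = e + 2 := ⟨d - 2, by omega⟩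
  simp only [show e + 2 - 1 = e + 1 by omega, Nat.add_sub_cancel]
  push_cast
  field_simp
  ring

theorem adap_smooth {d : ℕ} {p : ℝ} {Q u : ℝ → ℝ} (hQ : IsGroundState d p Q) (hd : 11 ≤ d)
    (hpos : ∀ y : ℝ, 0 ≤ y → 0 < Lam1 p Q y)
    (hu : ContDiff ℝ (⊤ : ℕ∞) u) (j : ℕ) :
    ContDiffOn ℝ (⊤ : ℕ∞) (adap d p Q j u) (Ioi 0) := by
  induction j with
  | zero => exact hu.contDiffOn
  | succ j ih =>
    have hdv : ContDiffOn ℝ (⊤ : ℕ∞) (deriv (adap d p Q j u)) (Ioi 0) :=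
      ih.deriv_of_isOpen isOpen_Ioi (by simp)
    have hW := hQ.W_smooth hpos
    rw [adap]
    split_ifs
    · exact hdv.neg.add (hW.mul ih)
    · refine ((hdv.add ((contDiffOn_const (c := (d:ℝ) - 1).div contDiffOn_id
        (fun y hy => (ne_of_gt hy))).mul ih)).add (hW.mul ih)).congr (fun y hy => ?_)
      exact Astar_eq hd y hy ((ih.differentiableOn (by simp)).differentiableAt
        (isOpen_Ioi.mem_nhds hy))

theorem adap_sys {d : ℕ} {p : ℝ} {Q u : ℝ → ℝ} (hQ : IsGroundState d p Q) (hd : 11 ≤ d)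
    (hpos : ∀ y : ℝ, 0 ≤ y → 0 < Lam1 p Q y)
    (hu : ContDiff ℝ (⊤ : ℕ∞) u) :
    Sys ((d:ℝ) - 1) adaps (adapw d p Q) (fun j => adap d p Q j u) := by
  intro j y hy
  have hdf := ((adap_smooth hQ hd hpos hu j).differentiableOn (by simp)).differentiableAt
    (isOpen_Ioi.mem_nhds hy)
  refine hdf.hasDerivAt.congr_deriv ?_
  have hW := hQ.W_eq hpos y hy
  rcases Nat.mod_two_eq_zero_or_one j with h | h
  · simp only [adap, h, if_true, Aop, adaps, adapw, hW]
    push_cast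
    ring
  · simp only [adap, h, one_ne_zero, if_false, Astar_eq hd y hy hdf, adaps, adapw, hW]
    push_cast
    ring

/-- **Equivalence of weighted adapted norms** (Lemma B.2): for every integer `k` there is
`c = c(d,p,k) ≥ 1` such that for every smooth radial `u`,
`(1/c) Σ_{i≤k} ∫ |D^i u|²/(1+y^{2k-2i}) ≤ Σ_{i≤k} ∫ u_i²/(1+y^{2k-2i})
  ≤ c Σ_{i≤k} ∫ |D^i u|²/(1+y^{2k-2i})`
(integrals over `ℝ^d`, possibly infinite). -/
theorem equivalence_of_adapted_norms (d : ℕ) (hd : 11 ≤ d) (p : ℝ) (hp1 : 1 < p)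
    (hp : pJL d < p) (Q : ℝ → ℝ) (hQ : IsGroundState d p Q)
    (hpos : ∀ y : ℝ, 0 ≤ y → 0 < Lam1 p Q y) (k : ℕ) :
    ∃ c : ℝ, 1 ≤ c ∧ ∀ u : ℝ → ℝ, ContDiff ℝ (⊤ : ℕ∞) u →
      ((∑ i ∈ Finset.range (k + 1), ∫⁻ y in Ioi (0:ℝ),
          ENNReal.ofReal ((adap d p Q i u y) ^ 2 / (1 + y ^ (2 * (k - i))) * y ^ (d - 1))) ≤
        ENNReal.ofReal c * ∑ i ∈ Finset.range (k + 1), ∫⁻ y in Ioi (0:ℝ),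
          ENNReal.ofReal ((Dop d i u y) ^ 2 / (1 + y ^ (2 * (k - i))) * y ^ (d - 1))) ∧
      ((∑ i ∈ Finset.range (k + 1), ∫⁻ y in Ioi (0:ℝ),
          ENNReal.ofReal ((Dop d i u y) ^ 2 / (1 + y ^ (2 * (k - i))) * y ^ (d - 1))) ≤
        ENNReal.ofReal c * ∑ i ∈ Finset.range (k + 1), ∫⁻ y in Ioi (0:ℝ),
          ENNReal.ofReal ((adap d p Q i u y) ^ 2 / (1 + y ^ (2 * (k - i))) * y ^ (d - 1))) := by
  obtain ⟨hD, hA⟩ := And.intro (fun j => Sym.zero (-2)) (adapw_sym hQ hd hp1 hpos)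
  obtain ⟨c1, h1, k1⟩ := oneside d ((d:ℝ) - 1) (fun _ => 1) adaps (fun _ _ => 0)
    (adapw d p Q) hD hA adaps_sq k
  obtain ⟨c2, h2, k2⟩ := oneside d ((d:ℝ) - 1) adaps (fun _ => 1) (adapw d p Q)
    (fun _ _ => 0) hA hD (fun _ => by norm_num) k
  refine ⟨max c1 c2, le_max_of_le_left h1, fun u hu => ⟨?_, ?_⟩⟩
  · refine (k1 (fun j => Dop d j u) (fun j => adap d p Q j u) (Dop_sys hu)
      (adap_sys hQ hd hpos hu) (fun y hy => rfl)).trans ?_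
    gcongr
    exact le_max_left _ _
  · refine (k2 (fun j => adap d p Q j u) (fun j => Dop d j u)
      (adap_sys hQ hd hpos hu) (Dop_sys hu) (fun y hy => rfl)).trans ?_
    gcongr
    exact le_max_right _ _

end WaveBlowup
end
end
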